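/- arXiv:2401.13380 — 4 statements merged into one kernel-verified Lean document; each statement's English description precedes it below -/
import Mathlib

section
/- In the golf model on Z/nZ with parameters n, n_b, n_t, p, assume n_b + n_t = n and K := n_t − n_b ≥ 1. Then for every family (b_i)_{i∈Z/KZ} of nonnegative integers with Σ_i b_i = n_b, one has P(Δ_i TL = 2b_i for all i ∈ Z/KZ) = (2b_0 + 1) · Π_{i∈Z/KZ} C_{b_i} / binom(n, n_b). -/
open Finset MeasureTheory Filter Asymptotics
open scoped Classical

namespace Golf

/-- Canonical position of a vertex of the cycle `Z/nZ` in `{1, …, n}`. -/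
def cpos {n : ℕ} (v : Fin n) : ℕ := if v.val = 0 then n else v.val

/-- Shift a vertex by `d` steps in the positive direction. -/
def shiftR {n : ℕ} (v : Fin n) (d : ℕ) : Fin n :=
  ⟨(v.val + d) % n, Nat.mod_lt _ (Nat.lt_of_le_of_lt (Nat.zero_le _) v.isLt)⟩

/-- Shift a vertex by `d` steps in the negative direction. -/
def shiftL {n : ℕ} (v : Fin n) (d : ℕ) : Fin n := shiftR v (n - d % n)

/-- Distance (in `[1, n]`) from `v` to the nearest element of `H` in the positive direction. -/
def distR {n : ℕ} (H : Finset (Fin n)) (v : Fin n) : ℕ :=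
  if h : ((Finset.Icc 1 n).filter fun d => shiftR v d ∈ H).Nonempty then
    ((Finset.Icc 1 n).filter fun d => shiftR v d ∈ H).min' h
  else 0

/-- Distance (in `[1, n]`) from `v` to the nearest element of `H` in the negative direction. -/
def distL {n : ℕ} (H : Finset (Fin n)) (v : Fin n) : ℕ :=
  if h : ((Finset.Icc 1 n).filter fun d => shiftL v d ∈ H).Nonempty then
    ((Finset.Icc 1 n).filter fun d => shiftL v d ∈ H).min' h
  else 0

/-- Probability that the ball activated at `v` fills the nearest free hole in the positive
direction, when the current set of free holes is `H`, for the `p`-biased random walk. -/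
noncomputable def rightProb {n : ℕ} (p : ℝ) (H : Finset (Fin n)) (v : Fin n) : ℝ :=
  if p = 1 / 2 then (distL H v : ℝ) / ((distL H v : ℝ) + (distR H v : ℝ))
  else (1 - ((1 - p) / p) ^ distL H v) / (1 - ((1 - p) / p) ^ (distL H v + distR H v))

/-- New set of free holes after the ball at `v` makes its choice
(`true` = fill the nearest free hole in the positive direction). -/
def golfStep {n : ℕ} (H : Finset (Fin n)) (v : Fin n) (choice : Bool) : Finset (Fin n) :=
  if choice then H.erase (shiftR v (distR H v)) else H.erase (shiftL v (distL H v))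

/-- Final set of free holes after activating the listed balls with the listed choices. -/
def golfRun {n : ℕ} : List (Fin n) → List Bool → Finset (Fin n) → Finset (Fin n)
  | v :: vs, c :: cs, H => golfRun vs cs (golfStep H v c)
  | _, _, H => H

/-- Probability of a given sequence of left/right choices. -/
noncomputable def golfWeight {n : ℕ} (p : ℝ) :
    List (Fin n) → List Bool → Finset (Fin n) → ℝ
  | v :: vs, c :: cs, H =>
      (if c then rightProb p H v else 1 - rightProb p H v) * golfWeight p vs cs (golfStep H v c)
  | _, _, _ => 1

/-- Initial data of the golf model: an initial configuration with `nb` balls (listed in their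
activation order, encoded as an embedding `Fin nb ↪ Fin n`) and `nt` holes, the balls and holes
being on distinct vertices.  The initial configuration together with the activation order is
uniform on this set. -/
noncomputable def golfInit (n nb nt : ℕ) : Finset ((Fin nb ↪ Fin n) × Finset (Fin n)) :=
  Finset.univ.filter fun fT => fT.2.card = nt ∧ ∀ i, fT.1 i ∉ fT.2

/-- Expectation of `g B⁰ T⁰ TL` in the golf model on `Z/nZ` with `nb` balls, `nt` holes and
walk parameter `p`, where `B⁰` is the initial set of balls, `T⁰` the initial set of holes and
`TL` the final set of free holes. -/
noncomputable def golfExp (n nb nt : ℕ) (p : ℝ)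
    (g : Finset (Fin n) → Finset (Fin n) → Finset (Fin n) → ℝ) : ℝ :=
  (∑ fT ∈ golfInit n nb nt, ∑ cs : Fin nb → Bool,
      golfWeight p (List.ofFn ⇑fT.1) (List.ofFn cs) fT.2 *
        g (Finset.univ.map fT.1) fT.2 (golfRun (List.ofFn ⇑fT.1) (List.ofFn cs) fT.2)) /
    (golfInit n nb nt).card

/-- `golfProb n nb nt p X` is the probability that the final set of free holes is `X`. -/
noncomputable def golfProb (n nb nt : ℕ) (p : ℝ) (X : Finset (Fin n)) : ℝ :=
  golfExp n nb nt p fun _ _ TL => if TL = X then 1 else 0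

/-- Sorted list of the canonical positions of the elements of `X`. -/
def sortedPos {n : ℕ} (X : Finset (Fin n)) : List ℕ := (X.image cpos).sort (· ≤ ·)

/-- `blockSize X i` is the size `Δ_i X` of the `i`-th block of `X`. -/
def blockSize {n : ℕ} (X : Finset (Fin n)) (i : ℕ) : ℕ :=
  let q := sortedPos X
  let k := q.length
  (q.getD (i % k) 0 + n - q.getD ((i + k - 1) % k) 0 - 1) % n

/-- `blockSet X i` is the `i`-th block `B_i` of `X`: the set of vertices strictly between
`x_i` and `x_{i+1}` in the positive direction. -/
def blockSet {n : ℕ} (X : Finset (Fin n)) (i : ℕ) : Finset (Fin n) :=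
  let q := sortedPos X
  let k := q.length
  let lo := q.getD ((i + k - 1) % k) 0
  let hi := q.getD (i % k) 0
  Finset.univ.filter fun v =>
    if lo < hi then lo < cpos v ∧ cpos v < hi else cpos v < hi ∨ lo < cpos v

/-- Size of the largest block of `X`. -/
def maxBlockSize {n : ℕ} (X : Finset (Fin n)) : ℕ :=
  (Finset.range X.card).sup (blockSize X)

/-- `multinom3 a b c` is the multinomial coefficient `(a+b+c)! / (a! b! c!)`. -/
def multinom3 (a b c : ℕ) : ℕ :=
  (a + b + c).factorial / (a.factorial * b.factorial * c.factorial)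

end Golf

namespace Golf

theorem shiftR_val {n : ℕ} (v : Fin n) (d : ℕ) : (shiftR v d).val = (v.val + d) % n := rfl

theorem shiftR_zero {n : ℕ} (v : Fin n) : shiftR v 0 = v := by
  ext; simp [shiftR_val, Nat.mod_eq_of_lt v.isLt]

theorem shiftR_shiftR {n : ℕ} (v : Fin n) (a b : ℕ) :
    shiftR (shiftR v a) b = shiftR v (a + b) := by
  ext; simp [shiftR_val, Nat.add_assoc]

theorem shiftR_self {n : ℕ} (v : Fin n) : shiftR v n = v := by
  ext; simp [shiftR_val, Nat.mod_eq_of_lt v.isLt]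

theorem shiftL_shiftR {n : ℕ} (v : Fin n) {a e : ℕ} (h : e ≤ a) :
    shiftL (shiftR v a) e = shiftR v (a - e) := by
  obtain ⟨c, rfl⟩ := Nat.exists_eq_add_of_le h
  have hn : 0 < n := Nat.lt_of_le_of_lt (Nat.zero_le _) v.isLt
  have h1 : e + c + (n - e % n) = c + n * (e / n + 1) := by
    have := Nat.div_add_mod e n
    have := Nat.mod_lt e hn
    rw [Nat.mul_add, Nat.mul_one]
    omega
  rw [shiftL, shiftR_shiftR, h1, Nat.add_sub_cancel_left]
  ext
  rw [shiftR_val, shiftR_val, ← Nat.add_assoc, Nat.add_mul_mod_self_left]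

theorem shiftR_shiftL {n : ℕ} (v : Fin n) (d : ℕ) : shiftR (shiftL v d) d = v := by
  have hn : 0 < n := Nat.lt_of_le_of_lt (Nat.zero_le _) v.isLt
  have h1 : n - d % n + d = n * (d / n + 1) := by
    have := Nat.div_add_mod d n
    have := Nat.mod_lt d hn
    rw [Nat.mul_add, Nat.mul_one]
    omega
  rw [shiftL, shiftR_shiftR, h1]
  ext
  rw [shiftR_val, Nat.add_mul_mod_self_left, Nat.mod_eq_of_lt v.isLt]

theorem shiftL_of_shiftR {n : ℕ} {v w : Fin n} {d : ℕ} (h : shiftR w d = v) : shiftL v d = w := by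
  rw [← h, shiftL_shiftR _ le_rfl, Nat.sub_self, shiftR_zero]

theorem exists_shiftR_eq {n : ℕ} (v w : Fin n) : ∃ d, 1 ≤ d ∧ d ≤ n ∧ shiftR v d = w := by
  have hv := v.isLt
  have hw := w.isLt
  by_cases h : v.val < w.val
  · refine ⟨w.val - v.val, by omega, by omega, ?_⟩
    ext
    rw [shiftR_val, Nat.add_sub_cancel' h.le, Nat.mod_eq_of_lt hw]
  · refine ⟨w.val + n - v.val, by omega, by omega, ?_⟩
    ext
    rw [shiftR_val, Nat.add_sub_cancel' (by omega), Nat.add_mod_right, Nat.mod_eq_of_lt hw]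

theorem distR_spec {n : ℕ} {H : Finset (Fin n)} (hH : H.Nonempty) (v : Fin n) :
    1 ≤ distR H v ∧ distR H v ≤ n ∧ shiftR v (distR H v) ∈ H ∧
      ∀ e, 1 ≤ e → e < distR H v → shiftR v e ∉ H := by
  obtain ⟨w, hw⟩ := hH
  obtain ⟨d, h1, h2, rfl⟩ := exists_shiftR_eq v w
  have hne : ((Finset.Icc 1 n).filter fun d => shiftR v d ∈ H).Nonempty :=
    ⟨d, by simp [h1, h2, hw]⟩
  have hd : distR H v = ((Finset.Icc 1 n).filter fun d => shiftR v d ∈ H).min' hne := by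
    rw [distR, dif_pos hne]
  have hm := Finset.min'_mem _ hne
  rw [← hd, Finset.mem_filter, Finset.mem_Icc] at hm
  refine ⟨hm.1.1, hm.1.2, hm.2, fun e he1 he2 heH => ?_⟩
  have hen : e ≤ n := he2.le.trans hm.1.2
  have := Finset.min'_le ((Finset.Icc 1 n).filter fun d => shiftR v d ∈ H) e
    (Finset.mem_filter.2 ⟨Finset.mem_Icc.2 ⟨he1, hen⟩, heH⟩)
  omega

theorem distL_spec {n : ℕ} {H : Finset (Fin n)} (hH : H.Nonempty) (v : Fin n) :
    1 ≤ distL H v ∧ distL H v ≤ n ∧ shiftL v (distL H v) ∈ H ∧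
      ∀ e, 1 ≤ e → e < distL H v → shiftL v e ∉ H := by
  obtain ⟨w, hw⟩ := hH
  obtain ⟨d, h1, h2, hwd⟩ := exists_shiftR_eq w v
  rw [← shiftL_of_shiftR hwd] at hw
  have hne : ((Finset.Icc 1 n).filter fun d => shiftL v d ∈ H).Nonempty :=
    ⟨d, by simp [h1, h2, hw]⟩
  have hd : distL H v = ((Finset.Icc 1 n).filter fun d => shiftL v d ∈ H).min' hne := by
    rw [distL, dif_pos hne]
  have hm := Finset.min'_mem _ hne
  rw [← hd, Finset.mem_filter, Finset.mem_Icc] at hm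
  refine ⟨hm.1.1, hm.1.2, hm.2, fun e he1 he2 heH => ?_⟩
  have hen : e ≤ n := he2.le.trans hm.1.2
  have := Finset.min'_le ((Finset.Icc 1 n).filter fun d => shiftL v d ∈ H) e
    (Finset.mem_filter.2 ⟨Finset.mem_Icc.2 ⟨he1, hen⟩, heH⟩)
  omega

theorem distR_eq {n : ℕ} {H : Finset (Fin n)} {v : Fin n} {d : ℕ} (h1 : 1 ≤ d)
    (hmem : shiftR v d ∈ H) (hmin : ∀ e, 1 ≤ e → e < d → shiftR v e ∉ H) : distR H v = d := by
  obtain ⟨s1, -, s3, s4⟩ := distR_spec ⟨_, hmem⟩ v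
  rcases lt_trichotomy (distR H v) d with h | h | h
  · exact absurd s3 (hmin _ s1 h)
  · exact h
  · exact absurd hmem (s4 _ h1 h)

theorem distL_eq {n : ℕ} {H : Finset (Fin n)} {v : Fin n} {d : ℕ} (h1 : 1 ≤ d)
    (hmem : shiftL v d ∈ H) (hmin : ∀ e, 1 ≤ e → e < d → shiftL v e ∉ H) : distL H v = d := by
  obtain ⟨s1, -, s3, s4⟩ := distL_spec ⟨_, hmem⟩ v
  rcases lt_trichotomy (distL H v) d with h | h | h
  · exact absurd s3 (hmin _ s1 h)
  · exact h
  · exact absurd hmem (s4 _ h1 h)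

/-- The free hole filled by the ball at `v`, for the given choice of direction. -/
def filledHole {n : ℕ} (H : Finset (Fin n)) (v : Fin n) (c : Bool) : Fin n :=
  if c then shiftR v (distR H v) else shiftL v (distL H v)

theorem golfStep_eq_erase {n : ℕ} (H : Finset (Fin n)) (v : Fin n) (c : Bool) :
    golfStep H v c = H.erase (filledHole H v c) := by
  cases c <;> rfl

theorem filledHole_mem {n : ℕ} {H : Finset (Fin n)} (hH : H.Nonempty) (v : Fin n) (c : Bool) :
    filledHole H v c ∈ H := by
  cases c
  · exact (distL_spec hH v).2.2.1
  · exact (distR_spec hH v).2.2.1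

/-- The probability that the ball at `v` makes the given choice of direction. -/
noncomputable def choiceProb {n : ℕ} (p : ℝ) (H : Finset (Fin n)) (v : Fin n) (c : Bool) : ℝ :=
  if c then rightProb p H v else 1 - rightProb p H v

theorem sum_choiceProb {n : ℕ} (p : ℝ) (H : Finset (Fin n)) (v : Fin n) :
    ∑ c, choiceProb p H v c = 1 := by
  simp [choiceProb]

/-- The inclusion of the `x`-th block of `X`, with its left end point `x`, into the cycle. -/
def blockEmb {n : ℕ} (X : Finset (Fin n)) (x : Fin n) (j : Fin (distR X x)) : Fin n :=
  shiftR x j.val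

/-- The trace of a set on a block, seen as a subset of the cycle obtained by gluing the two end
points of the block. -/
def blockTrace {n : ℕ} (X : Finset (Fin n)) (x : Fin n) (S : Finset (Fin n)) :
    Finset (Fin (distR X x)) :=
  Finset.univ.filter fun j => blockEmb X x j ∈ S

theorem mem_blockTrace {n : ℕ} {X : Finset (Fin n)} {x : Fin n} {S : Finset (Fin n)}
    {j : Fin (distR X x)} : j ∈ blockTrace X x S ↔ blockEmb X x j ∈ S := by
  simp [blockTrace]

theorem exists_blockEmb_eq {n : ℕ} {X : Finset (Fin n)} (hX : X.Nonempty) (v : Fin n) :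
    ∃ x ∈ X, ∃ j, blockEmb X x j = v := by
  by_cases hv : v ∈ X
  · exact ⟨v, hv, ⟨0, (distR_spec hX v).1⟩, shiftR_zero v⟩
  · obtain ⟨s1, s2, s3, s4⟩ := distL_spec hX v
    set d := distL X v
    set x := shiftL v d with hx
    have hxd : shiftR x d = v := shiftR_shiftL v d
    refine ⟨x, s3, ⟨d, ?_⟩, hxd⟩
    obtain ⟨t1, t2, t3, t4⟩ := distR_spec hX x
    by_contra! hlt
    rcases hlt.lt_or_eq with h | h
    · refine s4 (d - distR X x) (by omega) (by omega) ?_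
      rwa [← hxd, shiftL_shiftR _ (by omega), Nat.sub_sub_self hlt]
    · rw [h, hxd] at t3
      exact hv t3

theorem blockEmb_inj {n : ℕ} {X : Finset (Fin n)} {x y : Fin n} (hx : x ∈ X) (hy : y ∈ X)
    {i : Fin (distR X x)} {j : Fin (distR X y)} (h : blockEmb X x i = blockEmb X y j) :
    x = y ∧ i.val = j.val := by
  have key : ∀ {x y : Fin n}, x ∈ X → ∀ {i j : ℕ}, j < distR X y → shiftR x i = shiftR y j →
      i ≤ j → x = y ∧ i = j := by
    intro x y hx i j hj h hij
    have h1 := shiftL_shiftR x (le_refl i)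
    rw [h, shiftL_shiftR y hij, Nat.sub_self, shiftR_zero] at h1
    have h2 : j - i = 0 := by
      by_contra h0
      refine (distR_spec ⟨x, hx⟩ y).2.2.2 (j - i) (by omega) (by omega) ?_
      rwa [h1]
    rw [h2, shiftR_zero] at h1
    exact ⟨h1.symm, by omega⟩
  rcases le_total i.val j.val with hij | hij
  · exact key hx j.isLt h hij
  · obtain ⟨h1, h2⟩ := key hy i.isLt h.symm hij
    exact ⟨h1.symm, h2.symm⟩

theorem blockEmb_mem_iff {n : ℕ} {X : Finset (Fin n)} {x : Fin n} (hx : x ∈ X)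
    {j : Fin (distR X x)} : blockEmb X x j ∈ X ↔ j.val = 0 := by
  constructor
  · intro h
    by_contra h0
    exact (distR_spec ⟨x, hx⟩ x).2.2.2 j (by omega) j.isLt h
  · intro h
    rwa [blockEmb, h, shiftR_zero]

/-- The distinguished vertex `0` of a cycle, as a set. -/
def origin (d : ℕ) : Finset (Fin d) := Finset.univ.filter fun j => j.val = 0

theorem blockTrace_self {n : ℕ} {X : Finset (Fin n)} {x : Fin n} (hx : x ∈ X) :
    blockTrace X x X = origin (distR X x) := by
  ext j
  simp [mem_blockTrace, blockEmb_mem_iff hx, origin]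

theorem distR_blockTrace {n : ℕ} {X H : Finset (Fin n)} {x : Fin n} (hx : x ∈ X) (hH : X ⊆ H)
    (v : Fin (distR X x)) :
    distR H (blockEmb X x v) = distR (blockTrace X x H) v ∧
      distR H (blockEmb X x v) + v.val ≤ distR X x := by
  obtain ⟨s1, s2, s3, s4⟩ := distR_spec ⟨x, hx⟩ x
  have hv := v.isLt
  have hend : shiftR (blockEmb X x v) (distR X x - v.val) ∈ H := by
    rw [blockEmb, shiftR_shiftR, Nat.add_sub_cancel' hv.le]
    exact hH s3
  obtain ⟨t1, t2, t3, t4⟩ := distR_spec ⟨_, hend⟩ (blockEmb X x v)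
  set d := distR H (blockEmb X x v)
  have hle : d ≤ distR X x - v.val := by
    by_contra! h
    exact t4 _ (by omega) h hend
  have hin : ∀ e, e ≤ distR X x - v.val → (blockEmb X x (shiftR v e) ∈ H ↔
      shiftR (blockEmb X x v) e ∈ H) := by
    intro e he
    rcases he.lt_or_eq with h | h
    · rw [blockEmb, blockEmb, shiftR_val, shiftR_shiftR, Nat.mod_eq_of_lt (by omega)]
    · have : (shiftR v e).val = 0 := by
        rw [shiftR_val, h, Nat.add_sub_cancel' hv.le, Nat.mod_self]
      refine iff_of_true (hH ((blockEmb_mem_iff hx).2 this)) ?_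
      rw [h]; exact hend
  refine ⟨(distR_eq t1 ?_ ?_).symm, by omega⟩
  · rw [mem_blockTrace, hin d hle]; exact t3
  · intro e he1 he2
    rw [mem_blockTrace, hin e (by omega)]
    exact t4 e he1 he2

theorem distL_blockTrace {n : ℕ} {X H : Finset (Fin n)} {x : Fin n} (hx : x ∈ X) (hH : X ⊆ H)
    (v : Fin (distR X x)) (hv0 : v.val ≠ 0) :
    distL H (blockEmb X x v) = distL (blockTrace X x H) v ∧
      distL H (blockEmb X x v) ≤ v.val := by
  have hv := v.isLt
  have hval : ∀ e, e ≤ v.val → (shiftL v e).val = v.val - e := by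
    intro e he
    have h : shiftR (⟨v.val - e, by omega⟩ : Fin (distR X x)) e = v := by
      ext
      rw [shiftR_val, Nat.sub_add_cancel he, Nat.mod_eq_of_lt hv]
    rw [shiftL_of_shiftR h]
  have hemb : ∀ e, e ≤ v.val → blockEmb X x (shiftL v e) = shiftL (blockEmb X x v) e := by
    intro e he
    rw [blockEmb, blockEmb, hval e he, shiftL_shiftR _ he]
  have hend : shiftL (blockEmb X x v) v.val ∈ H := by
    rw [blockEmb, shiftL_shiftR _ le_rfl, Nat.sub_self, shiftR_zero]
    exact hH hx
  obtain ⟨t1, t2, t3, t4⟩ := distL_spec ⟨_, hend⟩ (blockEmb X x v)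
  set d := distL H (blockEmb X x v)
  have hle : d ≤ v.val := by
    by_contra! h
    exact t4 _ (by omega) h hend
  refine ⟨(distL_eq t1 ?_ ?_).symm, hle⟩
  · rw [mem_blockTrace, hemb d hle]; exact t3
  · intro e he1 he2
    rw [mem_blockTrace, hemb e (by omega)]
    exact t4 e he1 he2

theorem filledHole_blockTrace {n : ℕ} {X H : Finset (Fin n)} {x : Fin n} (hx : x ∈ X)
    (hH : X ⊆ H) (v : Fin (distR X x)) (hv0 : v.val ≠ 0) (c : Bool) :
    filledHole H (blockEmb X x v) c = blockEmb X x (filledHole (blockTrace X x H) v c) ∨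
      (filledHole H (blockEmb X x v) c ∈ X ∧
        (filledHole (blockTrace X x H) v c).val = 0) := by
  have hv := v.isLt
  cases c
  · obtain ⟨h1, h2⟩ := distL_blockTrace hx hH v hv0
    left
    have h : shiftR (⟨v.val - distL H (blockEmb X x v), by omega⟩ : Fin (distR X x))
        (distL H (blockEmb X x v)) = v := by
      ext
      rw [shiftR_val, Nat.sub_add_cancel h2, Nat.mod_eq_of_lt hv]
    simp only [filledHole, Bool.false_eq_true, if_false]
    rw [← h1, shiftL_of_shiftR h]
    exact shiftL_shiftR x h2
  · obtain ⟨h1, h2⟩ := distR_blockTrace hx hH v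
    simp only [filledHole, if_true]
    rw [← h1]
    rcases h2.lt_or_eq with h | h
    · left
      have h3 : (v.val + distR H (blockEmb X x v)) % distR X x =
          v.val + distR H (blockEmb X x v) := Nat.mod_eq_of_lt (by omega)
      exact (shiftR_shiftR x _ _).trans (congrArg (shiftR x) h3.symm)
    · right
      constructor
      · have := (distR_spec ⟨x, hx⟩ x).2.2.1
        conv at this => rw [← h, Nat.add_comm, ← shiftR_shiftR]
        exact this
      · rw [shiftR_val, Nat.add_comm, h, Nat.mod_self]

theorem choiceProb_blockTrace {n : ℕ} (p : ℝ) {X H : Finset (Fin n)} {x : Fin n} (hx : x ∈ X)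
    (hH : X ⊆ H) (v : Fin (distR X x)) (hv0 : v.val ≠ 0) (c : Bool) :
    choiceProb p H (blockEmb X x v) c = choiceProb p (blockTrace X x H) v c := by
  simp only [choiceProb, rightProb, (distR_blockTrace hx hH v).1,
    (distL_blockTrace hx hH v hv0).1]


/-- The probability that the final set of free holes is `X`, when `k` balls occupying the set `B`
are activated in a uniform random order, starting from the set `H` of free holes. -/
noncomputable def golfAvg {n : ℕ} (p : ℝ) (X : Finset (Fin n)) :
    ℕ → Finset (Fin n) → Finset (Fin n) → ℝ
  | 0, _, H => if H = X then 1 else 0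
  | k + 1, B, H =>
      (∑ v ∈ B, ∑ c, choiceProb p H v c * golfAvg p X k (B.erase v) (golfStep H v c)) /
        ((k + 1 : ℕ) : ℝ)

/-- The probability that the final set of free holes is `X`, when the balls of the set `B`
are activated in a uniform random order, starting from the set `H` of free holes. -/
noncomputable def finalLaw {n : ℕ} (p : ℝ) (X B H : Finset (Fin n)) : ℝ :=
  golfAvg p X B.card B H

theorem finalLaw_empty {n : ℕ} (p : ℝ) (X H : Finset (Fin n)) :
    finalLaw p X ∅ H = if H = X then 1 else 0 := rfl

theorem card_mul_finalLaw {n : ℕ} (p : ℝ) (X B H : Finset (Fin n)) :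
    (B.card : ℝ) * finalLaw p X B H =
      ∑ v ∈ B, ∑ c, choiceProb p H v c * finalLaw p X (B.erase v) (golfStep H v c) := by
  rcases h : B.card with _ | k
  · rw [Finset.card_eq_zero] at h
    simp [h]
  · rw [finalLaw, h, golfAvg, mul_div_cancel₀ _ (by positivity)]
    refine Finset.sum_congr rfl fun v hv => ?_
    simp only [finalLaw, Finset.card_erase_of_mem hv, h, Nat.add_sub_cancel]

theorem sum_finalLaw {n : ℕ} (p : ℝ) (B H : Finset (Fin n)) : ∑ X, finalLaw p X B H = 1 := by
  induction hk : B.card generalizing B H with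
  | zero =>
    rw [Finset.card_eq_zero] at hk
    simp [hk, finalLaw_empty]
  | succ k ih =>
    have hne : (B.card : ℝ) ≠ 0 := by rw [hk]; positivity
    apply mul_left_cancel₀ hne
    rw [Finset.mul_sum, Finset.sum_congr rfl fun X _ => card_mul_finalLaw p X B H,
      Finset.sum_comm, mul_one, Finset.cast_card]
    refine Finset.sum_congr rfl fun v hv => ?_
    rw [Finset.sum_comm, ← sum_choiceProb p H v]
    refine Finset.sum_congr rfl fun c _ => ?_
    rw [← Finset.mul_sum, ih _ _ (by rw [Finset.card_erase_of_mem hv, hk, Nat.add_sub_cancel]),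
      mul_one]

theorem finalLaw_ne_zero {n : ℕ} {p : ℝ} {X B H : Finset (Fin n)} (h : finalLaw p X B H ≠ 0) :
    X ⊆ H ∧ (H.card = B.card + X.card ∨ X = ∅ ∧ H.card ≤ B.card) := by
  induction hk : B.card generalizing B H with
  | zero =>
    rw [Finset.card_eq_zero] at hk
    rw [hk, finalLaw_empty] at h
    have : H = X := by
      by_contra h0
      exact h (if_neg h0)
    subst this
    simp
  | succ k ih =>
    have h1 : (B.card : ℝ) * finalLaw p X B H ≠ 0 := mul_ne_zero (by rw [hk]; positivity) h
    rw [card_mul_finalLaw] at h1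
    obtain ⟨v, hv, h2⟩ := Finset.exists_ne_zero_of_sum_ne_zero h1
    obtain ⟨c, -, h3⟩ := Finset.exists_ne_zero_of_sum_ne_zero h2
    obtain ⟨h4, h5⟩ := ih (right_ne_zero_of_mul h3)
      (by rw [Finset.card_erase_of_mem hv, hk, Nat.add_sub_cancel])
    rw [golfStep_eq_erase] at h4 h5
    refine ⟨h4.trans (Finset.erase_subset _ _), ?_⟩
    rcases H.eq_empty_or_nonempty with hH | hH
    · subst hH
      right
      exact ⟨Finset.subset_empty.1 (h4.trans (Finset.erase_subset _ _)), by simp⟩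
    · have h6 := Finset.card_erase_add_one (filledHole_mem hH v c)
      rcases h5 with h5 | ⟨h5, h7⟩
      · left; omega
      · right; exact ⟨h5, by omega⟩

theorem finalLaw_eq_zero_of_not_subset {n : ℕ} {p : ℝ} {X B H : Finset (Fin n)} (h : ¬ X ⊆ H) :
    finalLaw p X B H = 0 := by
  by_contra h0
  exact h (finalLaw_ne_zero h0).1

theorem sum_blockTrace {n : ℕ} {X : Finset (Fin n)} (hX : X.Nonempty) (B : Finset (Fin n))
    (F : Fin n → ℝ) :
    ∑ v ∈ B, F v = ∑ x ∈ X, ∑ j ∈ blockTrace X x B, F (blockEmb X x j) := by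
  rw [Finset.sum_sigma']
  symm
  refine Finset.sum_bij (fun s _ => blockEmb X s.1 s.2) ?_ ?_ ?_ ?_
  · rintro ⟨x, j⟩ h
    exact mem_blockTrace.1 (Finset.mem_sigma.1 h).2
  · rintro ⟨x, i⟩ hx ⟨y, j⟩ hy h
    obtain ⟨h1, h2⟩ := blockEmb_inj (Finset.mem_sigma.1 hx).1 (Finset.mem_sigma.1 hy).1 h
    dsimp only at h1 h2
    subst h1
    rw [Fin.ext h2]
  · intro v hv
    obtain ⟨x, hx, j, rfl⟩ := exists_blockEmb_eq hX v
    exact ⟨⟨x, j⟩, Finset.mem_sigma.2 ⟨hx, mem_blockTrace.2 hv⟩, rfl⟩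
  · intros; rfl

theorem eq_of_blockTrace_eq {n : ℕ} {X : Finset (Fin n)} (hX : X.Nonempty) {S T : Finset (Fin n)}
    (h : ∀ x ∈ X, blockTrace X x S = blockTrace X x T) : S = T := by
  ext v
  obtain ⟨x, hx, j, rfl⟩ := exists_blockEmb_eq hX v
  rw [← mem_blockTrace, ← mem_blockTrace, h x hx]

theorem blockTrace_erase {n : ℕ} {X : Finset (Fin n)} {x : Fin n} (hx : x ∈ X)
    (S : Finset (Fin n)) (j : Fin (distR X x)) :
    blockTrace X x (S.erase (blockEmb X x j)) = (blockTrace X x S).erase j := by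
  ext i
  rw [mem_blockTrace, Finset.mem_erase, Finset.mem_erase, mem_blockTrace]
  refine and_congr (not_congr ⟨fun h => Fin.ext (blockEmb_inj hx hx h).2, fun h => ?_⟩) Iff.rfl
  rw [h]

theorem blockTrace_erase_of_ne {n : ℕ} {X : Finset (Fin n)} {x y : Fin n} (hx : x ∈ X)
    (hy : y ∈ X) (hxy : y ≠ x) (S : Finset (Fin n)) (j : Fin (distR X x)) :
    blockTrace X y (S.erase (blockEmb X x j)) = blockTrace X y S := by
  ext i
  rw [mem_blockTrace, Finset.mem_erase, mem_blockTrace]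
  exact and_iff_right fun h => hxy (blockEmb_inj hy hx h).1

theorem finalLaw_eq_prod {n : ℕ} (p : ℝ) {X B H : Finset (Fin n)} (hX : X.Nonempty) (hH : X ⊆ H)
    (hB : ∀ v ∈ B, v ∉ X) :
    finalLaw p X B H =
      ∏ x ∈ X, finalLaw p (origin (distR X x)) (blockTrace X x B) (blockTrace X x H) := by
  induction hk : B.card generalizing B H with
  | zero =>
    rw [Finset.card_eq_zero] at hk
    have h0 : ∀ x, blockTrace X x ∅ = ∅ := fun x => by simp [blockTrace]
    simp only [hk, h0, finalLaw_empty]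
    rw [Finset.prod_ite_zero, Finset.prod_const_one]
    congr 1
    refine propext ⟨?_, fun h => ?_⟩
    · rintro rfl x hx
      exact blockTrace_self hx
    · exact eq_of_blockTrace_eq hX fun x hx => (h x hx).trans (blockTrace_self hx).symm
  | succ k ih =>
    have hne : (B.card : ℝ) ≠ 0 := by rw [hk]; positivity
    apply mul_left_cancel₀ hne
    have hcard : (B.card : ℝ) = ∑ x ∈ X, ((blockTrace X x B).card : ℝ) := by
      rw [Finset.cast_card, sum_blockTrace hX]
      simp
    rw [card_mul_finalLaw, sum_blockTrace hX, hcard, Finset.sum_mul]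
    refine Finset.sum_congr rfl fun x hx => ?_
    rw [← Finset.mul_prod_erase X _ hx, ← mul_assoc, card_mul_finalLaw, Finset.sum_mul]
    refine Finset.sum_congr rfl fun j hj => ?_
    rw [Finset.sum_mul]
    refine Finset.sum_congr rfl fun c _ => ?_
    have hjB := mem_blockTrace.1 hj
    have hj0 : j.val ≠ 0 := fun h => hB _ hjB ((blockEmb_mem_iff hx).2 h)
    rw [choiceProb_blockTrace p hx hH j hj0 c, mul_assoc]
    congr 1
    rw [golfStep_eq_erase, golfStep_eq_erase]
    by_cases h0 : (filledHole (blockTrace X x H) j c).val = 0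
    · have hmem : filledHole H (blockEmb X x j) c ∈ X := by
        rcases filledHole_blockTrace hx hH j hj0 c with h | h
        · rw [h, blockEmb_mem_iff hx, h0]
        · exact h.1
      rw [finalLaw_eq_zero_of_not_subset fun h => Finset.notMem_erase _ _ (h hmem),
        finalLaw_eq_zero_of_not_subset (X := origin (distR X x)) fun h =>
          Finset.notMem_erase (filledHole (blockTrace X x H) j c) _ (h (by simp [origin, h0])),
        zero_mul]
    · have heq : filledHole H (blockEmb X x j) c =
          blockEmb X x (filledHole (blockTrace X x H) j c) := by
        rcases filledHole_blockTrace hx hH j hj0 c with h | h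
        · exact h
        · exact absurd h.2 h0
      rw [heq, ih, ← Finset.mul_prod_erase X _ hx, blockTrace_erase hx, blockTrace_erase hx]
      · congr 1
        refine Finset.prod_congr rfl fun y hy => ?_
        obtain ⟨hyx, hyX⟩ := Finset.mem_erase.1 hy
        rw [blockTrace_erase_of_ne hx hyX hyx, blockTrace_erase_of_ne hx hyX hyx]
      · intro y hy
        refine Finset.mem_erase.2 ⟨?_, hH hy⟩
        rintro rfl
        exact h0 ((blockEmb_mem_iff hx).1 hy)
      · intro v hv
        exact hB v (Finset.mem_of_mem_erase hv)
      · rw [Finset.card_erase_of_mem hjB, hk, Nat.add_sub_cancel]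

/-- The total weight of the target set `X`: the sum, over the initial sets of balls `B` whose
complement consists of holes, of the probability that the final set of free holes is `X`. -/
noncomputable def totalLaw {n : ℕ} (p : ℝ) (X : Finset (Fin n)) : ℝ :=
  ∑ B, finalLaw p X B Bᶜ

theorem totalLaw_eq_prod {n : ℕ} (p : ℝ) {X : Finset (Fin n)} (hX : X.Nonempty) :
    totalLaw p X = ∏ x ∈ X, totalLaw p (origin (distR X x)) := by
  have hcompl : ∀ x B, blockTrace X x Bᶜ = (blockTrace X x B)ᶜ := fun x B => by
    ext j; simp [mem_blockTrace]
  have hfac : ∀ B, finalLaw p X B Bᶜ = ∏ x ∈ X,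
      finalLaw p (origin (distR X x)) (blockTrace X x B) (blockTrace X x B)ᶜ := by
    intro B
    by_cases h : ∀ v ∈ B, v ∉ X
    · rw [finalLaw_eq_prod p hX (fun v hv => Finset.mem_compl.2 fun hB => h v hB hv) h]
      simp only [hcompl]
    · push Not at h
      obtain ⟨v, hvB, hvX⟩ := h
      rw [finalLaw_eq_zero_of_not_subset fun h => Finset.mem_compl.1 (h hvX) hvB]
      have hpos := (distR_spec hX v).1
      refine (Finset.prod_eq_zero hvX (finalLaw_eq_zero_of_not_subset fun h => ?_)).symm
      have h1 : (⟨0, hpos⟩ : Fin (distR X v)) ∈ origin (distR X v) := by simp [origin]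
      refine Finset.mem_compl.1 (h h1) (mem_blockTrace.2 ?_)
      rwa [blockEmb, shiftR_zero]
  simp only [totalLaw, hfac]
  rw [Finset.prod_sum]
  refine Finset.sum_bij (fun B _ => fun x _ => blockTrace X x B) ?_ ?_ ?_ ?_
  · intro B _
    simp
  · intro S _ T _ h
    exact eq_of_blockTrace_eq hX fun x hx => congrFun (congrFun h x) hx
  · intro g _
    refine ⟨Finset.univ.filter fun v => ∃ x, ∃ hx : x ∈ X, ∃ j ∈ g x hx, blockEmb X x j = v,
      Finset.mem_univ _, ?_⟩
    funext x hx
    ext j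
    simp only [mem_blockTrace, Finset.mem_filter, Finset.mem_univ, true_and]
    constructor
    · rintro ⟨y, hy, i, hi, h⟩
      obtain ⟨h1, h2⟩ := blockEmb_inj hy hx h
      subst h1
      rwa [← Fin.ext h2]
    · intro hj
      exact ⟨x, hx, j, hj, rfl⟩
  · intro B _
    rw [Finset.prod_attach X fun x =>
      finalLaw p (origin (distR X x)) (blockTrace X x B) (blockTrace X x B)ᶜ]

theorem totalLaw_singleton {n : ℕ} (p : ℝ) (x : Fin n) :
    totalLaw p {x} = totalLaw p (origin n) := by
  have h : distR {x} x = n := by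
    have hn : 1 ≤ n := Nat.lt_of_le_of_lt (Nat.zero_le _) x.isLt
    refine distR_eq hn (by simp [shiftR_self]) fun e he1 he2 he => ?_
    rw [Finset.mem_singleton] at he
    have h1 := congrArg Fin.val he
    rw [shiftR_val] at h1
    have hx := x.isLt
    by_cases hlt : x.val + e < n
    · rw [Nat.mod_eq_of_lt hlt] at h1; omega
    · rw [Nat.mod_eq_sub_mod (by omega), Nat.mod_eq_of_lt (by omega)] at h1; omega
  rw [totalLaw_eq_prod p (Finset.singleton_nonempty x), Finset.prod_singleton, h]

theorem totalLaw_eq_sum_powersetCard {n k : ℕ} (p : ℝ) {X : Finset (Fin n)} (hX : X.Nonempty)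
    (hk : 2 * k + X.card = n) :
    totalLaw p X = ∑ B ∈ Finset.powersetCard k Finset.univ, finalLaw p X B Bᶜ := by
  symm
  refine Finset.sum_subset (Finset.subset_univ _) fun B _ hB => ?_
  by_contra h
  rw [Finset.mem_powersetCard_univ] at hB
  have h1 := (finalLaw_ne_zero h).2
  have h2 := Finset.card_add_card_compl B
  rw [Fintype.card_fin] at h2
  rcases h1 with h1 | h1
  · omega
  · exact hX.ne_empty h1.1

theorem totalLaw_origin (p : ℝ) (b : ℕ) : totalLaw p (origin (2 * b + 1)) = catalan b := by
  have h1 : ∑ X ∈ Finset.powersetCard 1 (Finset.univ : Finset (Fin (2 * b + 1))), totalLaw p X =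
      ((2 * b + 1).choose b : ℝ) := by
    have hz : ∀ B ∈ Finset.powersetCard b (Finset.univ : Finset (Fin (2 * b + 1))),
        ∑ X ∈ Finset.powersetCard 1 Finset.univ, finalLaw p X B Bᶜ = 1 := by
      intro B hB
      rw [← sum_finalLaw p B Bᶜ]
      refine Finset.sum_subset (Finset.subset_univ _) fun X _ hX => ?_
      by_contra h
      rw [Finset.mem_powersetCard_univ] at hX hB
      have h1 := (finalLaw_ne_zero h).2
      have h2 := Finset.card_add_card_compl B
      rw [Fintype.card_fin] at h2
      omega
    rw [Finset.sum_congr rfl fun X hX => ?_, Finset.sum_comm, Finset.sum_congr rfl hz]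
    · simp
    · rw [Finset.mem_powersetCard_univ] at hX
      exact totalLaw_eq_sum_powersetCard p (Finset.card_pos.1 (by omega)) (by omega)
  rw [Finset.powersetCard_one, Finset.sum_map] at h1
  simp only [Function.Embedding.coeFn_mk, totalLaw_singleton, Finset.sum_const, nsmul_eq_mul,
    Finset.card_univ, Fintype.card_fin] at h1
  have h2 : (2 * b + 1) * catalan b = (2 * b + 1).choose b := by
    have h4 := succ_mul_catalan_eq_centralBinom b
    have h5 := Nat.add_one_mul_choose_eq (2 * b) b
    have h6 : (2 * b + 1).choose (b + 1) = (2 * b + 1).choose b :=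
      Nat.choose_symm_half b
    rw [h6, ← Nat.centralBinom_eq_two_mul_choose, ← h4] at h5
    apply Nat.eq_of_mul_eq_mul_right (Nat.succ_pos b)
    rw [Nat.succ_eq_add_one, ← h5]
    ring
  have h3 : ((2 * b + 1 : ℕ) : ℝ) ≠ 0 := by positivity
  apply mul_left_cancel₀ h3
  rw [h1, ← h2]
  push_cast
  ring


theorem sum_pi_fin_succ {α : Type*} [Fintype α] (k : ℕ) (F : (Fin (k + 1) → α) → ℝ) :
    ∑ f, F f = ∑ a, ∑ f : Fin k → α, F (Fin.cons a f) := by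
  rw [← (Fin.consEquiv fun _ => α).sum_comp, Fintype.sum_prod_type]
  rfl

theorem sum_golfRun_eq_finalLaw {n : ℕ} (p : ℝ) (X : Finset (Fin n)) (k : ℕ)
    (B H : Finset (Fin n)) (hB : B.card = k) :
    ∑ f : Fin k → Fin n, (if Finset.univ.image f = B then ∑ cs : Fin k → Bool,
        golfWeight p (List.ofFn f) (List.ofFn cs) H *
          (if golfRun (List.ofFn f) (List.ofFn cs) H = X then 1 else 0) else 0) =
      (k.factorial : ℝ) * finalLaw p X B H := by
  induction k generalizing B H with
  | zero =>
    rw [Finset.card_eq_zero] at hB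
    simp [hB, finalLaw_empty, golfRun, golfWeight]
  | succ k ih =>
    have himage : ∀ (v : Fin n) (f : Fin k → Fin n),
        Finset.univ.image (Fin.cons v f : Fin (k + 1) → Fin n) = B ↔
          v ∈ B ∧ Finset.univ.image f = B.erase v := by
      intro v f
      have h1 : Finset.univ.image (Fin.cons v f : Fin (k + 1) → Fin n) =
          insert v (Finset.univ.image f) := by
        ext w
        simp [Fin.exists_fin_succ, eq_comm]
      rw [h1]
      constructor
      · intro h
        have hv : v ∉ Finset.univ.image f := by
          intro hv
          rw [Finset.insert_eq_of_mem hv] at h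
          have h2 := Finset.card_image_le (s := Finset.univ) (f := f)
          rw [h, hB, Finset.card_univ, Fintype.card_fin] at h2
          omega
        exact ⟨h ▸ Finset.mem_insert_self _ _, by rw [← h, Finset.erase_insert hv]⟩
      · rintro ⟨hv, h⟩
        rw [h, Finset.insert_erase hv]
    have hfac : ((k + 1).factorial : ℝ) * finalLaw p X B H =
        k.factorial * ((B.card : ℝ) * finalLaw p X B H) := by
      rw [Nat.factorial_succ, hB]
      push_cast
      ring
    rw [hfac, card_mul_finalLaw, sum_pi_fin_succ,
      ← Finset.sum_filter_add_sum_filter_not Finset.univ (· ∈ B)]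
    rw [Finset.sum_eq_zero (s := Finset.univ.filter (· ∉ B)), add_zero,
      Finset.filter_univ_mem, Finset.mul_sum]
    · refine Finset.sum_congr rfl fun v hv => ?_
      have hcard : (B.erase v).card = k := by
        rw [Finset.card_erase_of_mem hv, hB, Nat.add_sub_cancel]
      have key : ∀ f : Fin k → Fin n,
          (if Finset.univ.image (Fin.cons v f : Fin (k + 1) → Fin n) = B then
            ∑ cs : Fin (k + 1) → Bool,
              golfWeight p (List.ofFn (Fin.cons v f : Fin (k + 1) → Fin n)) (List.ofFn cs) H *
              (if golfRun (List.ofFn (Fin.cons v f : Fin (k + 1) → Fin n)) (List.ofFn cs) H = X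
                then 1 else 0) else 0) =
          ∑ c, choiceProb p H v c * (if Finset.univ.image f = B.erase v then
            ∑ cs : Fin k → Bool, golfWeight p (List.ofFn f) (List.ofFn cs) (golfStep H v c) *
              (if golfRun (List.ofFn f) (List.ofFn cs) (golfStep H v c) = X then 1 else 0)
            else 0) := by
        intro f
        simp only [himage, hv, true_and]
        split_ifs
        · rw [sum_pi_fin_succ]
          refine Finset.sum_congr rfl fun c _ => ?_
          rw [Finset.mul_sum]
          refine Finset.sum_congr rfl fun cs _ => ?_
          rw [List.ofFn_succ, List.ofFn_succ]
          simp only [Fin.cons_zero, Fin.cons_succ, golfWeight, golfRun, choiceProb]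
          rw [mul_assoc]
        · simp
      rw [Finset.sum_congr rfl fun f _ => key f, Finset.sum_comm, Finset.mul_sum]
      refine Finset.sum_congr rfl fun c _ => ?_
      rw [← Finset.mul_sum, ih _ _ hcard]
      ring
    · intro v hv
      refine Finset.sum_eq_zero fun f _ => if_neg ?_
      rw [himage]
      exact fun h => (Finset.mem_filter.1 hv).2 h.1

theorem golfInit_eq_image {n nb nt : ℕ} (hsum : nb + nt = n) :
    golfInit n nb nt = Finset.univ.image
      fun f : Fin nb ↪ Fin n => (f, (Finset.univ.map f)ᶜ) := by
  ext ⟨f, T⟩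
  have hcard : ((Finset.univ.map f)ᶜ).card = nt := by
    rw [Finset.card_compl, Finset.card_map, Finset.card_univ, Fintype.card_fin, Fintype.card_fin]
    omega
  simp only [golfInit, Finset.mem_filter, Finset.mem_univ, true_and, Finset.mem_image,
    Prod.mk.injEq, exists_eq_left]
  constructor
  · rintro ⟨h1, h2⟩
    refine (Finset.eq_of_subset_of_card_le (fun v hv => ?_) (by omega)).symm
    simp only [Finset.mem_compl, Finset.mem_map, Finset.mem_univ, true_and, not_exists]
    rintro i rfl
    exact h2 i hv
  · rintro rfl
    exact ⟨hcard, fun i => by simp⟩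

theorem card_golfInit {n nb nt : ℕ} (hsum : nb + nt = n) :
    (golfInit n nb nt).card = nb.factorial * n.choose nb := by
  rw [golfInit_eq_image hsum, Finset.card_image_of_injective _ fun _ _ h => congrArg Prod.fst h,
    Finset.card_univ, Fintype.card_embedding_eq,
    Fintype.card_fin, Fintype.card_fin, Nat.descFactorial_eq_factorial_mul_choose]

theorem sum_embedding_eq {n k : ℕ} (F : (Fin k → Fin n) → Finset (Fin n) → ℝ) :
    ∑ f : Fin k ↪ Fin n, F f (Finset.univ.map f) =
      ∑ B ∈ Finset.powersetCard k Finset.univ, ∑ f : Fin k → Fin n,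
        if Finset.univ.image f = B then F f B else 0 := by
  rw [Finset.sum_comm]
  have h1 : ∀ f : Fin k → Fin n, (∑ B ∈ Finset.powersetCard k Finset.univ,
      if Finset.univ.image f = B then F f B else 0) =
      if Function.Injective f then F f (Finset.univ.image f) else 0 := by
    intro f
    rw [Finset.sum_ite_eq]
    congr 1
    have h2 := Finset.card_image_iff (s := Finset.univ) (f := f)
    rw [Finset.card_univ, Fintype.card_fin, Finset.coe_univ, Set.injOn_univ] at h2
    rw [Finset.mem_powersetCard_univ, h2]
  simp only [h1]
  rw [← Finset.sum_filter]
  refine Finset.sum_bij (fun f _ => ⇑f) ?_ ?_ ?_ ?_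
  · intro f _
    simp [f.injective]
  · intro f _ g _ h
    exact DFunLike.coe_injective h
  · intro f hf
    exact ⟨⟨f, (Finset.mem_filter.1 hf).2⟩, Finset.mem_univ _, rfl⟩
  · intro f _
    rw [Finset.map_eq_image]

theorem golfExp_indicator {n nb nt : ℕ} (hsum : nb + nt = n) (hlt : nb < nt) (p : ℝ)
    (P : Finset (Fin n) → Prop) [DecidablePred P] :
    (golfExp n nb nt p fun _ _ TL => if P TL then 1 else 0) =
      (∑ X ∈ Finset.univ.filter fun X => X.card = nt - nb ∧ P X, totalLaw p X) /
        (n.choose nb : ℝ) := by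
  rw [golfExp, card_golfInit hsum, golfInit_eq_image hsum,
    Finset.sum_image fun _ _ _ _ h => congrArg Prod.fst h]
  have h1 : ∀ Y : Finset (Fin n), (if P Y then 1 else 0 : ℝ) =
      ∑ X ∈ Finset.univ.filter P, if Y = X then 1 else 0 := by
    intro Y
    simp
  have h2 : ∀ f : Fin nb ↪ Fin n, (∑ cs : Fin nb → Bool,
      golfWeight p (List.ofFn ⇑f) (List.ofFn cs) (Finset.univ.map f)ᶜ *
        (if P (golfRun (List.ofFn ⇑f) (List.ofFn cs) (Finset.univ.map f)ᶜ) then 1 else 0)) =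
      ∑ X ∈ Finset.univ.filter P, ∑ cs : Fin nb → Bool,
        golfWeight p (List.ofFn ⇑f) (List.ofFn cs) (Finset.univ.map f)ᶜ *
          (if golfRun (List.ofFn ⇑f) (List.ofFn cs) (Finset.univ.map f)ᶜ = X then 1 else 0) := by
    intro f
    rw [Finset.sum_comm]
    refine Finset.sum_congr rfl fun cs _ => ?_
    rw [h1, Finset.mul_sum]
  have h3 : ∀ X : Finset (Fin n), (∑ f : Fin nb ↪ Fin n, ∑ cs : Fin nb → Bool,
        golfWeight p (List.ofFn ⇑f) (List.ofFn cs) (Finset.univ.map f)ᶜ *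
          (if golfRun (List.ofFn ⇑f) (List.ofFn cs) (Finset.univ.map f)ᶜ = X then 1 else 0)) =
      (nb.factorial : ℝ) * ∑ B ∈ Finset.powersetCard nb Finset.univ, finalLaw p X B Bᶜ := by
    intro X
    rw [sum_embedding_eq fun f B => ∑ cs : Fin nb → Bool,
        golfWeight p (List.ofFn f) (List.ofFn cs) Bᶜ *
          (if golfRun (List.ofFn f) (List.ofFn cs) Bᶜ = X then 1 else 0), Finset.mul_sum]
    refine Finset.sum_congr rfl fun B hB => ?_
    exact sum_golfRun_eq_finalLaw p X nb B Bᶜ (Finset.mem_powersetCard_univ.1 hB)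
  rw [Finset.sum_congr rfl fun f _ => h2 f, Finset.sum_comm, Finset.sum_congr rfl fun X _ => h3 X,
    ← Finset.mul_sum, Nat.cast_mul, mul_div_mul_left _ _ (by positivity)]
  congr 1
  rw [← Finset.sum_subset (s₁ := Finset.univ.filter fun X => X.card = nt - nb ∧ P X)]
  · refine Finset.sum_congr rfl fun X hX => ?_
    have hc := (Finset.mem_filter.1 hX).2.1
    exact (totalLaw_eq_sum_powersetCard p (Finset.card_pos.1 (by omega)) (by omega)).symm
  · intro X hX
    exact Finset.mem_filter.2 ⟨Finset.mem_univ _, (Finset.mem_filter.1 hX).2.2⟩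
  · intro X hX hX'
    refine Finset.sum_eq_zero fun B hB => ?_
    by_contra h
    refine hX' (Finset.mem_filter.2 ⟨Finset.mem_univ _, ?_, (Finset.mem_filter.1 hX).2⟩)
    rw [Finset.mem_powersetCard_univ] at hB
    have h4 := (finalLaw_ne_zero h).2
    have h5 := Finset.card_add_card_compl B
    rw [Fintype.card_fin] at h5
    omega


/-- The vertex of the cycle at position `m`, modulo `n`. -/
def vertexAt {n : ℕ} (hn : 0 < n) (m : ℕ) : Fin n := ⟨m % n, Nat.mod_lt _ hn⟩

theorem cpos_vertexAt {n : ℕ} (hn : 0 < n) {m : ℕ} (h1 : 1 ≤ m) (h2 : m ≤ n) :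
    cpos (vertexAt hn m) = m := by
  rcases h2.lt_or_eq with h | h
  · simp [cpos, vertexAt, Nat.mod_eq_of_lt h, Nat.ne_of_gt h1]
  · simp [cpos, vertexAt, h]

theorem vertexAt_cpos {n : ℕ} (hn : 0 < n) (v : Fin n) : vertexAt hn (cpos v) = v := by
  ext
  unfold cpos vertexAt
  split_ifs with h
  · simp [h]
  · simp [Nat.mod_eq_of_lt v.isLt]

theorem one_le_cpos {n : ℕ} (v : Fin n) : 1 ≤ cpos v := by
  have := v.isLt
  unfold cpos
  split_ifs <;> omega

theorem cpos_le {n : ℕ} (v : Fin n) : cpos v ≤ n := by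
  have := v.isLt
  unfold cpos
  split_ifs <;> omega

theorem cpos_injective {n : ℕ} : Function.Injective (cpos (n := n)) := fun v w h => by
  have hn : 0 < n := Nat.lt_of_le_of_lt (Nat.zero_le _) v.isLt
  rw [← vertexAt_cpos hn v, h, vertexAt_cpos]

theorem shiftR_vertexAt {n : ℕ} (hn : 0 < n) (m d : ℕ) :
    shiftR (vertexAt hn m) d = vertexAt hn (m + d) := by
  ext
  simp [shiftR_val, vertexAt]

theorem eq_of_vertexAt_eq {n : ℕ} (hn : 0 < n) {t i j : ℕ} (hi : t ≤ i) (hi' : i < t + n)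
    (hj : t ≤ j) (hj' : j < t + n) (h : vertexAt hn i = vertexAt hn j) : i = j := by
  have key : ∀ {i j : ℕ}, t ≤ i → j < t + n → i ≤ j → i % n = j % n → i = j := by
    intro i j hi hj hij h
    have h1 := (Nat.modEq_iff_dvd' hij).1 h
    have h2 := Nat.eq_zero_of_dvd_of_lt h1 (by omega)
    omega
  have h' : i % n = j % n := congrArg Fin.val h
  rcases le_total i j with hij | hij
  · exact key hi hj' hij h'
  · exact (key hj hi' hij h'.symm).symm

/-- The positions `t, t + g 1, t + g 1 + g 2, …`. -/
def gapPos (g : ℕ → ℕ) (t j : ℕ) : ℕ := t + ∑ i ∈ Finset.range j, g (i + 1)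

theorem le_gapPos (g : ℕ → ℕ) (t j : ℕ) : t ≤ gapPos g t j :=
  Nat.le_add_right _ _

theorem gapPos_zero (g : ℕ → ℕ) (t : ℕ) : gapPos g t 0 = t := by simp [gapPos]

theorem gapPos_succ (g : ℕ → ℕ) (t j : ℕ) : gapPos g t (j + 1) = gapPos g t j + g (j + 1) := by
  rw [gapPos, gapPos, Finset.sum_range_succ, Nat.add_assoc]

theorem gapPos_strictMono {g : ℕ → ℕ} (hg : ∀ i, 1 ≤ g i) (t : ℕ) : StrictMono (gapPos g t) :=
  strictMono_nat_of_lt_succ fun j => by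
    rw [gapPos_succ]
    have := hg (j + 1)
    omega

/-- The sequence `g` is a sequence of `K` positive cyclic gaps on the cycle `Z/nZ`. -/
structure IsGapSeq (n K : ℕ) (g : ℕ → ℕ) : Prop where
  pos : 0 < n
  one_le : 1 ≤ K
  one_le_gap : ∀ i, 1 ≤ g i
  sum_gap : ∑ i ∈ Finset.range K, g (i + 1) = n
  periodic : g K = g 0

/-- The set of the vertices at the first `K` positions of `gapPos g t`. -/
def gapSet {n : ℕ} (hn : 0 < n) (g : ℕ → ℕ) (K t : ℕ) : Finset (Fin n) :=
  (Finset.range K).image fun j => vertexAt hn (gapPos g t j)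

namespace IsGapSeq

variable {n K : ℕ} {g : ℕ → ℕ}

theorem gapPos_last (h : IsGapSeq n K g) (t : ℕ) : gapPos g t K = t + n := by
  rw [gapPos, h.sum_gap]

theorem gapPos_pred (h : IsGapSeq n K g) (t : ℕ) : gapPos g t (K - 1) + g 0 = t + n := by
  rw [← h.gapPos_last, ← h.periodic]
  have := gapPos_succ g t (K - 1)
  rw [Nat.sub_add_cancel h.one_le] at this
  exact this.symm

theorem gap_le (h : IsGapSeq n K g) {i : ℕ} (hi : i < K) : g (i + 1) ≤ n := by
  rw [← h.sum_gap]
  exact Finset.single_le_sum (f := fun i => g (i + 1)) (fun _ _ => Nat.zero_le _)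
    (Finset.mem_range.2 hi)

theorem gapPos_lt (h : IsGapSeq n K g) (t : ℕ) {j : ℕ} (hj : j < K) : gapPos g t j < t + n := by
  rw [← h.gapPos_last]
  exact gapPos_strictMono h.one_le_gap t hj

theorem gapPos_le (h : IsGapSeq n K g) {t j : ℕ} (ht : t ≤ g 0) (hj : j < K) :
    gapPos g t j ≤ n := by
  have h1 := (gapPos_strictMono h.one_le_gap t).monotone (show j ≤ K - 1 by omega)
  have h2 := h.gapPos_pred t
  omega

theorem image_cpos_gapSet (h : IsGapSeq n K g) {t : ℕ} (ht1 : 1 ≤ t) (ht : t ≤ g 0) :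
    (gapSet h.pos g K t).image cpos = ((List.range K).map (gapPos g t)).toFinset := by
  ext m
  simp only [gapSet, Finset.image_image, Finset.mem_image, Finset.mem_range, List.mem_toFinset,
    List.mem_map, List.mem_range, Function.comp_apply]
  refine exists_congr fun j => and_congr_right fun hj => ?_
  rw [cpos_vertexAt h.pos (ht1.trans (le_gapPos g t j)) (h.gapPos_le ht hj)]

theorem sortedPos_gapSet (h : IsGapSeq n K g) {t : ℕ} (ht1 : 1 ≤ t) (ht : t ≤ g 0) :
    sortedPos (gapSet h.pos g K t) = (List.range K).map (gapPos g t) := by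
  have hmono := gapPos_strictMono h.one_le_gap t
  rw [sortedPos, h.image_cpos_gapSet ht1 ht,
    List.toFinset_sort _ (List.nodup_range.map hmono.injective), List.pairwise_map]
  exact List.pairwise_lt_range.imp fun hab => (hmono hab).le

theorem card_gapSet (h : IsGapSeq n K g) {t : ℕ} (ht1 : 1 ≤ t) (ht : t ≤ g 0) :
    (gapSet h.pos g K t).card = K := by
  have h1 := congrArg List.length (h.sortedPos_gapSet ht1 ht)
  rwa [sortedPos, Finset.length_sort, Finset.card_image_of_injective _ cpos_injective,
    List.length_map, List.length_range] at h1

theorem blockSize_gapSet (h : IsGapSeq n K g) {t : ℕ} (ht1 : 1 ≤ t) (ht : t ≤ g 0) {i : ℕ}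
    (hi : i < K) : blockSize (gapSet h.pos g K t) i + 1 = g i := by
  have hget : ∀ j, j < K → ((List.range K).map (gapPos g t)).getD j 0 = gapPos g t j := by
    intro j hj
    simp [List.getD, hj]
  have hK := h.one_le
  simp only [blockSize, h.sortedPos_gapSet ht1 ht, List.length_map, List.length_range]
  rw [hget _ (Nat.mod_lt _ hK), hget _ (Nat.mod_lt _ hK), Nat.mod_eq_of_lt hi]
  rcases i with _ | j
  · rw [Nat.zero_add, Nat.mod_eq_of_lt (show K - 1 < K by omega), gapPos_zero]
    have h1 := h.gapPos_pred t
    have h2 := h.gap_le (show K - 1 < K by omega)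
    rw [Nat.sub_add_cancel hK, h.periodic] at h2
    have h3 := h.one_le_gap 0
    rw [show t + n - gapPos g t (K - 1) - 1 = g 0 - 1 by omega, Nat.mod_eq_of_lt (by omega)]
    omega
  · rw [show j + 1 + K - 1 = j + K by omega, Nat.add_mod_right,
      Nat.mod_eq_of_lt (show j < K by omega), gapPos_succ]
    have h2 := h.gap_le (show j < K by omega)
    have h3 := h.one_le_gap (j + 1)
    have hn := h.pos
    rw [show gapPos g t j + g (j + 1) + n - gapPos g t j - 1 = g (j + 1) - 1 + n by omega,
      Nat.add_mod_right, Nat.mod_eq_of_lt (by omega)]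
    omega

theorem exists_eq_gapSet (h : IsGapSeq n K g) {X : Finset (Fin n)} (hX : X.card = K)
    (hb : ∀ i, i < K → blockSize X i + 1 = g i) :
    ∃ t, (1 ≤ t ∧ t ≤ g 0) ∧ gapSet h.pos g K t = X := by
  have hlen : (sortedPos X).length = K := by
    rw [sortedPos, Finset.length_sort, Finset.card_image_of_injective _ cpos_injective, hX]
  have hK := h.one_le
  set q := sortedPos X with hq
  have hmem : ∀ m, m ∈ q ↔ m ∈ X.image cpos := fun m => by rw [hq, sortedPos, Finset.mem_sort]
  have hget : ∀ j, j < K → q.getD j 0 ∈ q := by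
    intro j hj
    rw [List.getD_eq_getElem _ _ (by omega)]
    exact List.getElem_mem _
  have hbd : ∀ j, j < K → 1 ≤ q.getD j 0 ∧ q.getD j 0 ≤ n := by
    intro j hj
    obtain ⟨v, -, hv⟩ := Finset.mem_image.1 ((hmem _).1 (hget j hj))
    rw [← hv]
    exact ⟨one_le_cpos v, cpos_le v⟩
  have hlt : ∀ j, j + 1 < K → q.getD j 0 < q.getD (j + 1) 0 := by
    intro j hj
    rw [List.getD_eq_getElem _ _ (by omega), List.getD_eq_getElem _ _ (by omega)]
    exact (Finset.sortedLT_sort (X.image cpos)).strictMono_get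
      (show (⟨j, by omega⟩ : Fin q.length) < ⟨j + 1, by omega⟩ from Nat.lt_succ_self j)
  set t := q.getD 0 0 with ht
  have hpos : ∀ j, j < K → q.getD j 0 = gapPos g t j := by
    intro j hj
    induction j with
    | zero => rw [gapPos_zero]
    | succ j ih =>
      have ih := ih (by omega)
      have h1 := hb (j + 1) hj
      have h2 := hlt j hj
      have h3 := hbd (j + 1) hj
      have h4 := hbd j (by omega)
      simp only [blockSize] at h1
      rw [← hq, hlen, Nat.mod_eq_of_lt hj, show j + 1 + K - 1 = j + K by omega, Nat.add_mod_right,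
        Nat.mod_eq_of_lt (by omega : j < K),
        show q.getD (j + 1) 0 + n - q.getD j 0 - 1 = q.getD (j + 1) 0 - q.getD j 0 - 1 + n by omega,
        Nat.add_mod_right, Nat.mod_eq_of_lt (by omega)] at h1
      rw [gapPos_succ, ← ih, ← h1]
      omega
  have ht1 : 1 ≤ t := (hbd 0 (by omega)).1
  have htg : t ≤ g 0 := by
    have h1 := h.gapPos_pred t
    have h2 := (hbd (K - 1) (by omega)).2
    rw [hpos _ (by omega)] at h2
    omega
  refine ⟨t, ⟨ht1, htg⟩, Finset.image_injective cpos_injective ?_⟩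
  rw [h.image_cpos_gapSet ht1 htg]
  ext m
  rw [← hmem, List.mem_toFinset]
  have hqe : (List.range K).map (gapPos g t) = q := by
    refine List.ext_getElem (by simp [hlen]) fun j hj1 hj2 => ?_
    rw [← List.getD_eq_getElem q 0 hj2, hpos j (by omega)]
    simp
  rw [hqe]

theorem gapSet_injOn (h : IsGapSeq n K g) :
    Set.InjOn (gapSet h.pos g K) (Finset.Icc 1 (g 0) : Finset ℕ) := by
  intro s hs t ht hst
  rw [Finset.mem_coe, Finset.mem_Icc] at hs ht
  have h1 := h.sortedPos_gapSet hs.1 hs.2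
  rw [hst, h.sortedPos_gapSet ht.1 ht.2] at h1
  have h2 := List.map_inj_left.1 h1 0 (List.mem_range.2 h.one_le)
  rw [gapPos_zero, gapPos_zero] at h2
  exact h2.symm

theorem distR_gapSet (h : IsGapSeq n K g) (t : ℕ) {j : ℕ} (hj : j < K) :
    distR (gapSet h.pos g K t) (vertexAt h.pos (gapPos g t j)) = g (j + 1) := by
  have hmono := gapPos_strictMono h.one_le_gap t
  refine distR_eq (h.one_le_gap _) ?_ fun e he1 he2 he => ?_
  · rw [shiftR_vertexAt, ← gapPos_succ]
    rcases Nat.lt_or_eq_of_le (Nat.succ_le_of_lt hj) with h1 | h1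
    · exact Finset.mem_image.2 ⟨j + 1, Finset.mem_range.2 h1, rfl⟩
    · refine Finset.mem_image.2 ⟨0, Finset.mem_range.2 h.one_le, ?_⟩
      rw [gapPos_zero, show j + 1 = K from h1, h.gapPos_last]
      ext
      simp [vertexAt]
  · rw [shiftR_vertexAt] at he
    obtain ⟨i, hi, heq⟩ := Finset.mem_image.1 he
    rw [Finset.mem_range] at hi
    have h1 := hmono.monotone (Nat.succ_le_of_lt hj)
    rw [h.gapPos_last, Nat.succ_eq_add_one, gapPos_succ] at h1
    have h2 := le_gapPos g t j
    have h3 := eq_of_vertexAt_eq h.pos (le_gapPos g t i) (h.gapPos_lt t hi)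
      (by omega) (by omega) heq
    have h4 : j < i := hmono.lt_iff_lt.1 (by omega)
    have h5 : i < j + 1 := hmono.lt_iff_lt.1 (by rw [gapPos_succ]; omega)
    omega

theorem prod_gapSet (h : IsGapSeq n K g) (t : ℕ) (F : ℕ → ℝ) :
    ∏ x ∈ gapSet h.pos g K t, F (distR (gapSet h.pos g K t) x) =
      ∏ i ∈ Finset.range K, F (g i) := by
  have h1 : ∏ x ∈ gapSet h.pos g K t, F (distR (gapSet h.pos g K t) x) =
      ∏ j ∈ Finset.range K, F (g (j + 1)) := by
    conv_lhs => rw [gapSet]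
    rw [Finset.prod_image]
    · refine Finset.prod_congr rfl fun j hj => ?_
      rw [← gapSet, h.distR_gapSet t (Finset.mem_range.1 hj)]
    · intro i hi j hj hij
      exact (gapPos_strictMono h.one_le_gap t).injective
        (eq_of_vertexAt_eq h.pos (le_gapPos g t i) (h.gapPos_lt t (Finset.mem_range.1 hi))
          (le_gapPos g t j) (h.gapPos_lt t (Finset.mem_range.1 hj)) hij)
  obtain ⟨m, rfl⟩ := Nat.exists_eq_succ_of_ne_zero (Nat.one_le_iff_ne_zero.1 h.one_le)
  rw [h1, Finset.prod_range_succ, ← Nat.succ_eq_add_one, h.periodic, Finset.prod_range_succ']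

end IsGapSeq

end Golf

open Golf

/-- **Law of the block sizes in the dense golf model on `Z/nZ`** (Equation (20) of the paper).
When `nb + nt = n` and `K = nt - nb ≥ 1`, for every family `(b_i)_{i ∈ Z/KZ}` of nonnegative
integers with `Σ b_i = nb`,
`P(Δ_i TL = 2 b_i for all i) = (2 b_0 + 1) · Π_i C_{b_i} / binom(n, nb)`. -/
theorem golf_block_sizes_law (n nb nt : ℕ) (hn : 1 ≤ n) (hsum : nb + nt = n)
    (hK : 1 ≤ nt - nb) (p : ℝ) (hp0 : 0 < p) (hp1 : p < 1)
    (b : Fin (nt - nb) → ℕ) (hb : ∑ i, b i = nb) :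
    (golfExp n nb nt p fun _ _ TL =>
        if ∀ i : Fin (nt - nb), blockSize TL i.val = 2 * b i then 1 else 0) =
      ((2 * (b ⟨0, hK⟩ : ℝ) + 1) * ∏ i : Fin (nt - nb), (catalan (b i) : ℝ)) /
        (n.choose nb : ℝ) := by
  set c : ℕ → ℕ := fun i => b ⟨i % (nt - nb), Nat.mod_lt _ hK⟩ with hc
  have hcb : ∀ i : Fin (nt - nb), c i.val = b i := fun i => by
    rw [hc]
    exact congrArg b (Fin.ext (Nat.mod_eq_of_lt i.isLt))
  have hcK : c (nt - nb) = c 0 := by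
    rw [hc]
    exact congrArg b (Fin.ext (by simp))
  have hgap : IsGapSeq n (nt - nb) fun i => 2 * c i + 1 := by
    refine ⟨hn, hK, fun i => by omega, ?_, by simp only [hcK]⟩
    have h1 : ∑ i ∈ Finset.range (nt - nb), c (i + 1) = ∑ i ∈ Finset.range (nt - nb), c i := by
      have h2 := Finset.sum_range_succ c (nt - nb)
      rw [Finset.sum_range_succ', hcK] at h2
      omega
    rw [Finset.sum_add_distrib, ← Finset.mul_sum, h1, Finset.sum_range, Finset.sum_const,
      Finset.card_range, Finset.sum_congr rfl fun i _ => hcb i, hb, smul_eq_mul]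
    omega
  have hset : (Finset.univ.filter fun X : Finset (Fin n) => X.card = (nt - nb) ∧
      ∀ i : Fin (nt - nb), blockSize X i.val = 2 * b i) =
      (Finset.Icc 1 (2 * c 0 + 1)).image (gapSet hgap.pos (fun i => 2 * c i + 1) (nt - nb)) := by
    ext X
    rw [Finset.mem_filter, Finset.mem_image]
    constructor
    · rintro ⟨-, h1, h2⟩
      obtain ⟨t, ht, rfl⟩ := hgap.exists_eq_gapSet h1 fun i hi => by
        rw [h2 ⟨i, hi⟩, ← hcb]
      exact ⟨t, Finset.mem_Icc.2 ht, rfl⟩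
    · rintro ⟨t, ht, rfl⟩
      rw [Finset.mem_Icc] at ht
      refine ⟨Finset.mem_univ _, hgap.card_gapSet ht.1 ht.2, fun i => ?_⟩
      have h1 := hgap.blockSize_gapSet ht.1 ht.2 i.isLt
      rw [← hcb]
      omega
  have hlaw : ∀ t ∈ Finset.Icc 1 (2 * c 0 + 1),
      totalLaw p (gapSet hgap.pos (fun i => 2 * c i + 1) (nt - nb) t) = ∏ i, (catalan (b i) : ℝ) := by
    intro t ht
    rw [Finset.mem_Icc] at ht
    have hne : (gapSet hgap.pos (fun i => 2 * c i + 1) (nt - nb) t).Nonempty := by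
      rw [← Finset.card_pos, hgap.card_gapSet ht.1 ht.2]
      exact hK
    rw [totalLaw_eq_prod p hne, hgap.prod_gapSet t fun d => totalLaw p (origin d),
      Finset.prod_range]
    refine Finset.prod_congr rfl fun i _ => ?_
    rw [hcb, totalLaw_origin]
  rw [golfExp_indicator hsum (by omega) p fun X => ∀ i : Fin (nt - nb), blockSize X i.val = 2 * b i, hset, Finset.sum_image hgap.gapSet_injOn,
    Finset.sum_congr rfl hlaw, Finset.sum_const, Nat.card_Icc, nsmul_eq_mul, ← hcb ⟨0, hK⟩]
  push_cast
  ring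
end

section
/- Let K ≥ 2 and n_b ≥ 0 be integers and set n_t = n_b + K. Then ∫_{D} x_0 · n_b! · n_t! · Σ_{(b_i)∈ℕ^K, Σ_{i=0}^{K−1} b_i = n_b} Π_{i=0}^{K−1} x_i^{2b_i} / (b_i!·(b_i+1)!) dx_0 ⋯ dx_{K−2} = 1, where the integral is with respect to Lebesgue measure on the domain D = {(x_0,…,x_{K−2}) ∈ ℝ^{K−1} : x_i ≥ 0 for all i, Σ_{i=0}^{K−2} x_i ≤ 1} and where x_{K−1} := 1 − Σ_{i=0}^{K−2} x_i. -/
open MeasureTheory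

namespace Golf

/-- Completion of a point of `ℝ^{K-1}` into a point of `ℝ^K` whose last coordinate is
`1` minus the sum of the others. -/
noncomputable def extendSimplex (K : ℕ) (x : Fin (K - 1) → ℝ) : Fin K → ℝ :=
  fun i => if h : i.val < K - 1 then x ⟨i.val, h⟩ else 1 - ∑ j, x j

end Golf

open Golf

section CatalanConvolution

open PowerSeries

theorem two_mul_add_succ_choose (n k : ℕ) :
    (2 * (n + 1) + (k + 1)).choose (n + 1) =
      (2 * (n + 1) + k).choose (n + 1) + (2 * n + (k + 2)).choose n := by
  rw [show 2 * (n + 1) + (k + 1) = (2 * n + (k + 2)) + 1 by ring, Nat.choose_succ_succ',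
    show 2 * (n + 1) + k = 2 * n + (k + 2) by ring, add_comm]

theorem two_mul_succ_choose (n : ℕ) :
    (2 * (n + 1)).choose (n + 1) = 2 * (2 * n + 1).choose n := by
  rw [show 2 * (n + 1) = (2 * n + 1) + 1 by ring, Nat.choose_succ_succ',
    Nat.choose_symm_half]
  ring

theorem two_mul_add_one_choose_eq_catalan (n : ℕ) :
    (2 * n + 1).choose n = (2 * n + 1) * catalan n := by
  have h := Nat.add_one_mul_choose_eq (2 * n) n
  rw [← Nat.centralBinom_eq_two_mul_choose, ← succ_mul_catalan_eq_centralBinom,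
    Nat.choose_symm_half] at h
  apply Nat.eq_of_mul_eq_mul_right (Nat.succ_pos n)
  rw [Nat.succ_eq_add_one, ← h]
  ring

theorem two_mul_succ_add_one_choose (n : ℕ) :
    (2 * (n + 1) + 1).choose (n + 1) = catalan (n + 1) + 2 * (2 * n + 2).choose n := by
  have h1 := two_mul_add_one_choose_eq_catalan (n + 1)
  have h2 := two_mul_add_succ_choose n 0
  have h3 := succ_mul_catalan_eq_centralBinom (n + 1)
  rw [Nat.centralBinom_eq_two_mul_choose] at h3
  simp only [add_zero, zero_add] at h2
  linarith

theorem coeff_catalan_mul_choose (n k : ℕ) :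
    coeff n ((mk catalan : ℕ⟦X⟧) * mk fun n => (2 * n + k).choose n) =
      (2 * n + (k + 1)).choose n := by
  have hstep (k : ℕ) : (mk fun n => (2 * n + (k + 1)).choose n : ℕ⟦X⟧) =
      (mk fun n => (2 * n + k).choose n) + X * mk fun n => (2 * n + (k + 2)).choose n := by
    ext n
    cases n with
    | zero => simp
    | succ n => simp only [map_add, coeff_succ_X_mul, coeff_mk, two_mul_add_succ_choose]
  have hzero : (mk fun n => (2 * n + 0).choose n : ℕ⟦X⟧) =
      1 + X * (2 * mk fun n => (2 * n + (0 + 1)).choose n) := by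
    ext n
    cases n with
    | zero => simp
    | succ n =>
      rw [two_mul (mk _)]
      simp only [map_add, coeff_succ_X_mul, coeff_mk, coeff_one, add_zero, zero_add,
        two_mul_succ_choose]
      simp [two_mul]
  induction n generalizing k with
  | zero => simp [coeff_mul]
  | succ n ih =>
    induction k with
    | zero =>
      rw [hzero, mul_add, mul_one, mul_left_comm, mul_left_comm _ 2, two_mul (_ * _), map_add,
        coeff_succ_X_mul, map_add, ih, coeff_mk, zero_add, two_mul_succ_add_one_choose]
      ring
    | succ k ihk =>
      rw [hstep, mul_add, mul_left_comm, map_add, ihk, coeff_succ_X_mul, ih,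
        two_mul_add_succ_choose n (k + 1)]

theorem catalan_pow_mul_choose (j k : ℕ) :
    (mk catalan : ℕ⟦X⟧) ^ j * (mk fun n => (2 * n + k).choose n) =
      mk fun n => (2 * n + (k + j)).choose n := by
  induction j with
  | zero => simp
  | succ j ih =>
    rw [pow_succ', mul_assoc, ih]
    ext n
    rw [coeff_catalan_mul_choose, coeff_mk, add_assoc]

theorem sum_antidiagonalTuple_succ {M : Type*} [AddCommMonoid M] (k n : ℕ)
    (f : (Fin (k + 1) → ℕ) → M) :
    ∑ b ∈ Finset.Nat.antidiagonalTuple (k + 1) n, f b =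
      ∑ p ∈ Finset.HasAntidiagonal.antidiagonal n, ∑ b ∈ Finset.Nat.antidiagonalTuple k p.2, f (Fin.cons p.1 b) := by
  rw [Finset.sum_sigma']
  refine Finset.sum_bij' (fun b _ => ⟨(b 0, ∑ i, Fin.tail b i), Fin.tail b⟩)
    (fun p _ => Fin.cons p.1.1 p.2) ?_ ?_ ?_ ?_ ?_
  · intro b hb
    rw [Finset.Nat.mem_antidiagonalTuple, Fin.sum_univ_succ] at hb
    simpa [Finset.Nat.mem_antidiagonalTuple, Fin.tail] using hb
  · rintro ⟨⟨i, j⟩, b⟩ h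
    simp only [Finset.mem_sigma, Finset.HasAntidiagonal.mem_antidiagonal,
      Finset.Nat.mem_antidiagonalTuple] at h
    simp [Finset.Nat.mem_antidiagonalTuple, Fin.sum_univ_succ, h.1, h.2]
  · intro b _
    simp
  · rintro ⟨⟨i, j⟩, b⟩ h
    simp only [Finset.mem_sigma, Finset.HasAntidiagonal.mem_antidiagonal,
      Finset.Nat.mem_antidiagonalTuple] at h
    simp [h.2]
  · intro b _
    simp

theorem coeff_mk_pow_eq_sum_antidiagonalTuple {R : Type*} [CommSemiring R] (f : ℕ → R)
    (k n : ℕ) :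
    coeff n ((mk f) ^ k) = ∑ b ∈ Finset.Nat.antidiagonalTuple k n, ∏ i, f (b i) := by
  induction k generalizing n with
  | zero => cases n <;> simp [coeff_one]
  | succ k ih =>
    rw [sum_antidiagonalTuple_succ, pow_succ', coeff_mul]
    refine Finset.sum_congr rfl fun p _ => ?_
    simp [ih, Fin.prod_univ_succ, Finset.mul_sum]

theorem sum_antidiagonalTuple_catalan (k n : ℕ) :
    ∑ b ∈ Finset.Nat.antidiagonalTuple (k + 1) n, (2 * b 0 + 1) * ∏ i, catalan (b i) =
      (2 * n + (k + 1)).choose n := by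
  have h := congrArg (coeff n) (catalan_pow_mul_choose k 1)
  rw [coeff_mk, add_comm 1 k, mul_comm, coeff_mul] at h
  rw [sum_antidiagonalTuple_succ, ← h]
  refine Finset.sum_congr rfl fun p _ => ?_
  simp [coeff_mk_pow_eq_sum_antidiagonalTuple, Fin.prod_univ_succ, Finset.mul_sum,
    two_mul_add_one_choose_eq_catalan, mul_assoc]

end CatalanConvolution

section DirichletIntegral

open scoped Nat

theorem intervalIntegral_pow_mul_sub_pow (s : ℝ) (a b : ℕ) :
    ∫ t in (0 : ℝ)..s, t ^ a * (s - t) ^ b =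
      a ! * b ! / (a + b + 1)! * s ^ (a + b + 1) := by
  induction a generalizing b with
  | zero =>
    simp only [pow_zero, one_mul]
    rw [intervalIntegral.integral_comp_sub_left (fun t => t ^ b) s, integral_pow]
    simp [Nat.factorial_succ]
    field_simp
  | succ a ih =>
    have hparts := intervalIntegral.integral_mul_deriv_eq_deriv_mul
      (u := fun t : ℝ => t ^ (a + 1)) (u' := fun t => (a + 1) * t ^ a)
      (v := fun t : ℝ => -((s - t) ^ (b + 1)) / (b + 1)) (v' := fun t => (s - t) ^ b)
      (a := 0) (b := s)
      (fun t _ => by simpa using hasDerivAt_pow (a + 1) t)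
      (fun t _ => by
        have h : HasDerivAt (fun t => -((s - t) ^ (b + 1)) / (b + 1 : ℝ))
            (-(((b + 1 : ℕ) : ℝ) * (s - t) ^ b * -1) / (b + 1)) t :=
          ((((hasDerivAt_id t).const_sub s).pow (b + 1)).neg).div_const (b + 1 : ℝ)
        have hderiv : -(((b + 1 : ℕ) : ℝ) * (s - t) ^ b * -1) / (b + 1) = (s - t) ^ b := by
          push_cast
          field_simp
        rw [hderiv] at h
        exact h)
      (by apply Continuous.intervalIntegrable; fun_prop)
      (by apply Continuous.intervalIntegrable; fun_prop)
    rw [hparts]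
    have hcongr : (fun t : ℝ => (a + 1) * t ^ a * (-((s - t) ^ (b + 1)) / (b + 1))) =
        fun t => (-((a + 1) / (b + 1)) : ℝ) * (t ^ a * (s - t) ^ (b + 1)) := by
      ext t; ring
    rw [hcongr, intervalIntegral.integral_const_mul, ih (b + 1),
      show a + 1 + b + 1 = a + (b + 1) + 1 by ring]
    simp only [Nat.factorial_succ a, Nat.factorial_succ b]
    push_cast
    simp
    field_simp

/-- The solid simplex of nonnegative vectors whose coordinates sum to at most `s`. -/
def solidSimplex (m : ℕ) (s : ℝ) : Set (Fin m → ℝ) :=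
  {x | (∀ i, 0 ≤ x i) ∧ ∑ i, x i ≤ s}

theorem isCompact_solidSimplex (m : ℕ) (s : ℝ) : IsCompact (solidSimplex m s) := by
  refine (isCompact_univ_pi fun _ => isCompact_Icc (a := (0 : ℝ)) (b := s)).of_isClosed_subset
    ?_ ?_
  · refine IsClosed.inter ?_ ?_
    · change IsClosed {x : Fin m → ℝ | ∀ i, 0 ≤ x i}
      simp only [Set.ofPred_forall]
      exact isClosed_iInter fun i => isClosed_le continuous_const (continuous_apply i)
    · exact isClosed_le (continuous_finsetSum _ fun i _ => continuous_apply i) continuous_const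
  · rintro x ⟨h0, h1⟩ i -
    exact ⟨h0 i, (Finset.single_le_sum (fun j _ => h0 j) (Finset.mem_univ i)).trans h1⟩

theorem cons_mem_solidSimplex {m : ℕ} {s t : ℝ} {y : Fin m → ℝ} :
    (Fin.cons t y : Fin (m + 1) → ℝ) ∈ solidSimplex (m + 1) s ↔
      0 ≤ t ∧ y ∈ solidSimplex m (s - t) := by
  simp only [solidSimplex, Set.mem_ofPred_eq, Fin.forall_fin_succ, Fin.cons_zero, Fin.cons_succ,
    Fin.sum_univ_succ, and_assoc, le_sub_iff_add_le']

theorem setIntegral_solidSimplex_succ (m : ℕ) (s : ℝ) (f : (Fin (m + 1) → ℝ) → ℝ)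
    (hf : Continuous f) :
    ∫ x in solidSimplex (m + 1) s, f x =
      ∫ t in Set.Icc 0 s, ∫ y in solidSimplex m (s - t), f (Fin.cons t y) := by
  have hmeas (m : ℕ) (s : ℝ) : MeasurableSet (solidSimplex m s) :=
    (isCompact_solidSimplex m s).measurableSet
  have hmp := (volume_preserving_piFinSuccAbove (fun _ : Fin (m + 1) => ℝ) 0).symm
  have hint : Integrable ((solidSimplex (m + 1) s).indicator f) :=
    (hf.continuousOn.integrableOn_compact (isCompact_solidSimplex _ _)).integrable_indicator
      (hmeas _ _)
  rw [← integral_indicator (hmeas _ _), ← integral_indicator measurableSet_Icc,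
    ← hmp.integral_comp']
  rw [Measure.volume_eq_prod, integral_prod]
  · refine integral_congr_ae (Filter.Eventually.of_forall fun t => ?_)
    have hcons (y : Fin m → ℝ) :
        (MeasurableEquiv.piFinSuccAbove (fun _ : Fin (m + 1) => ℝ) 0).symm (t, y) =
          Fin.cons t y := by
      simp [MeasurableEquiv.piFinSuccAbove, Fin.insertNthEquiv]
    trans ∫ y, (solidSimplex (m + 1) s).indicator f (Fin.cons t y)
    · exact integral_congr_ae (Filter.Eventually.of_forall fun y => congrArg _ (hcons y))
    by_cases ht : t ∈ Set.Icc 0 s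
    · rw [Set.indicator_of_mem ht, ← integral_indicator (hmeas _ _)]
      refine integral_congr_ae (Filter.Eventually.of_forall fun y => ?_)
      by_cases hy : y ∈ solidSimplex m (s - t)
      · exact (Set.indicator_of_mem (cons_mem_solidSimplex.2 ⟨ht.1, hy⟩) f).trans
          (Set.indicator_of_mem hy fun y => f (Fin.cons t y)).symm
      · exact (Set.indicator_of_notMem (fun h => hy (cons_mem_solidSimplex.1 h).2) f).trans
          (Set.indicator_of_notMem hy fun y => f (Fin.cons t y)).symm
    · rw [Set.indicator_of_notMem ht]
      apply integral_eq_zero_of_ae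
      refine Filter.Eventually.of_forall fun y => Set.indicator_of_notMem (fun hy => ht ?_) _
      obtain ⟨h0, h1, h2⟩ := cons_mem_solidSimplex.1 hy
      exact ⟨h0, by linarith [Finset.sum_nonneg fun i (_ : i ∈ Finset.univ) => h1 i]⟩
  · exact (hmp.integrable_comp_emb (MeasurableEquiv.measurableEmbedding _)).2 hint

/-- **Dirichlet's integral** with natural exponents. -/
theorem setIntegral_solidSimplex_prod_pow (m : ℕ) (a : Fin m → ℕ) (c : ℕ) {s : ℝ}
    (hs : 0 ≤ s) :
    ∫ x in solidSimplex m s, (∏ i, x i ^ a i) * (s - ∑ i, x i) ^ c =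
      (∏ i, ((a i)! : ℝ)) * c ! / (∑ i, a i + c + m)! * s ^ (∑ i, a i + c + m) := by
  induction m generalizing s with
  | zero =>
    have huniv : solidSimplex 0 s = Set.univ := by
      ext x; simp [solidSimplex, hs]
    rw [huniv, Measure.restrict_univ, volume_pi, Measure.pi_of_empty, integral_dirac]
    simp
    field_simp
  | succ m ih =>
    rw [setIntegral_solidSimplex_succ _ _ _ (by fun_prop)]
    have hinner : ∀ t ∈ Set.Icc 0 s,
        ∫ y in solidSimplex m (s - t), (∏ i, (Fin.cons t y : Fin (m + 1) → ℝ) i ^ a i) *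
            (s - ∑ i, (Fin.cons t y : Fin (m + 1) → ℝ) i) ^ c =
          ((∏ i, ((a (Fin.succ i))! : ℝ)) * c ! / (∑ i, a (Fin.succ i) + c + m)!) *
            (t ^ a 0 * (s - t) ^ (∑ i, a (Fin.succ i) + c + m)) := by
      intro t ht
      have h := ih (fun i => a i.succ) (s := s - t) (by linarith [ht.2])
      simp only [Fin.prod_univ_succ, Fin.sum_univ_succ, Fin.cons_zero, Fin.cons_succ,
        ← sub_sub, mul_assoc]
      rw [integral_const_mul, h]
      ring
    rw [setIntegral_congr_fun measurableSet_Icc hinner, integral_Icc_eq_integral_Ioc,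
      ← intervalIntegral.integral_of_le hs, intervalIntegral.integral_const_mul,
      intervalIntegral_pow_mul_sub_pow, Fin.prod_univ_succ, Fin.sum_univ_succ,
      show a 0 + (∑ i : Fin m, a i.succ + c + m) + 1 =
        a 0 + ∑ i : Fin m, a i.succ + c + (m + 1) by ring]
    field_simp

end DirichletIntegral

theorem extendSimplex_castSucc (m : ℕ) (x : Fin (m + 1) → ℝ) (i : Fin (m + 1)) :
    extendSimplex (m + 2) x i.castSucc = x i := by
  have h := i.isLt
  simp only [extendSimplex, Fin.val_castSucc]
  rw [dif_pos (by omega)]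
  rfl

theorem extendSimplex_last (m : ℕ) (x : Fin (m + 1) → ℝ) :
    extendSimplex (m + 2) x (Fin.last (m + 1)) = 1 - ∑ j, x j := by
  simp [extendSimplex]

theorem factorial_two_mul_div_eq_catalan (n : ℕ) :
    ((2 * n).factorial : ℝ) / ((n.factorial * (n + 1).factorial : ℕ) : ℝ) = catalan n := by
  have h1 := Nat.choose_mul_factorial_mul_factorial (show n ≤ 2 * n by omega)
  rw [← Nat.centralBinom_eq_two_mul_choose, ← succ_mul_catalan_eq_centralBinom,
    show 2 * n - n = n by omega] at h1
  rw [div_eq_iff (by positivity), ← h1, Nat.factorial_succ]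
  push_cast
  ring

theorem setIntegral_mul_prod_extendSimplex (m : ℕ) (b : Fin (m + 2) → ℕ) :
    ∫ x in solidSimplex (m + 1) 1, x 0 * ∏ i, extendSimplex (m + 2) x i ^ (2 * b i) /
        (((b i).factorial * (b i + 1).factorial : ℕ) : ℝ) =
      (2 * b 0 + 1 : ℝ) * (∏ i, (catalan (b i) : ℝ)) / (2 * ∑ i, b i + (m + 2)).factorial := by
  have h := setIntegral_solidSimplex_prod_pow (m + 1)
    (Fin.cons (2 * b 0 + 1) fun i : Fin m => 2 * b i.succ.castSucc) (2 * b (Fin.last _))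
    zero_le_one
  have hexp : ∑ i, (Fin.cons (2 * b 0 + 1) fun i : Fin m => 2 * b i.succ.castSucc :
      Fin (m + 1) → ℕ) i + 2 * b (Fin.last _) + (m + 1) = 2 * ∑ i, b i + (m + 2) := by
    rw [Fin.sum_univ_castSucc b, Fin.sum_univ_succ, Fin.sum_univ_succ]
    simp only [Fin.cons_zero, Fin.cons_succ, Fin.castSucc_zero, ← Finset.mul_sum]
    ring
  have hcongr (x : Fin (m + 1) → ℝ) :
      x 0 * ∏ i, extendSimplex (m + 2) x i ^ (2 * b i) /
        (((b i).factorial * (b i + 1).factorial : ℕ) : ℝ) =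
      (∏ i, (((b i).factorial * (b i + 1).factorial : ℕ) : ℝ))⁻¹ *
      ((∏ i, x i ^ (Fin.cons (2 * b 0 + 1) fun i : Fin m => 2 * b i.succ.castSucc :
        Fin (m + 1) → ℕ) i) * (1 - ∑ i, x i) ^ (2 * b (Fin.last _))) := by
    rw [Finset.prod_div_distrib, Fin.prod_univ_castSucc (fun i => _ ^ (2 * b i))]
    simp only [extendSimplex_castSucc, extendSimplex_last]
    rw [Fin.prod_univ_succ, Fin.prod_univ_succ (fun i => x i ^ _)]
    simp only [Fin.cons_zero, Fin.cons_succ, Fin.castSucc_zero]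
    ring
  have hfact : (∏ i, (((Fin.cons (2 * b 0 + 1) fun i : Fin m => 2 * b i.succ.castSucc :
        Fin (m + 1) → ℕ) i).factorial : ℝ)) * (2 * b (Fin.last _)).factorial =
      (2 * b 0 + 1 : ℝ) * ∏ i, ((2 * b i).factorial : ℝ) := by
    rw [Fin.prod_univ_castSucc (fun i => ((2 * b i).factorial : ℝ)), Fin.prod_univ_succ,
      Fin.prod_univ_succ]
    simp only [Fin.cons_zero, Fin.cons_succ, Fin.castSucc_zero, Nat.factorial_succ]
    push_cast
    ring
  simp only [hcongr]
  rw [integral_const_mul, h, hexp, one_pow, mul_one]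
  simp only [← factorial_two_mul_div_eq_catalan]
  rw [Finset.prod_div_distrib, ← mul_div_assoc (2 * b 0 + 1 : ℝ), ← hfact]
  ring

theorem continuous_extendSimplex (m : ℕ) (i : Fin (m + 2)) :
    Continuous fun x : Fin (m + 1) → ℝ => extendSimplex (m + 2) x i := by
  cases i using Fin.lastCases with
  | last => simp only [extendSimplex_last]; fun_prop
  | cast i => simp only [extendSimplex_castSucc]; fun_prop

/-- **The sparse-case density integrates to one** (Equation (13) of the paper): for `K ≥ 2`,
`nb ≥ 0` and `nt = nb + K`,
`∫_D x_0 · nb! · nt! · Σ_{(b_i) : Σ b_i = nb} Π_i x_i^{2 b_i}/(b_i! (b_i+1)!) dx = 1`,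
where `D = {x ∈ ℝ^{K-1} : x_i ≥ 0, Σ x_i ≤ 1}` and `x_{K-1} = 1 - Σ_{i<K-1} x_i`. -/
theorem sparse_density_integral_eq_one (K nb : ℕ) (hK : 2 ≤ K) :
    ∫ x in {x : Fin (K - 1) → ℝ | (∀ i, 0 ≤ x i) ∧ ∑ i, x i ≤ 1},
      (x (⟨0, by omega⟩ : Fin (K - 1))) * (nb.factorial : ℝ) * ((nb + K).factorial : ℝ) *
        ∑ b ∈ Finset.Nat.antidiagonalTuple K nb,
          ∏ i : Fin K,
            extendSimplex K x i ^ (2 * b i) /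
              (((b i).factorial * (b i + 1).factorial : ℕ) : ℝ) = 1 := by
  obtain ⟨m, rfl⟩ : ∃ m, K = m + 2 := ⟨K - 2, by omega⟩
  change ∫ x in solidSimplex (m + 1) 1, x 0 * (nb.factorial : ℝ) *
    ((nb + (m + 2)).factorial : ℝ) * ∑ b ∈ Finset.Nat.antidiagonalTuple (m + 2) nb,
      ∏ i, extendSimplex (m + 2) x i ^ (2 * b i) /
        (((b i).factorial * (b i + 1).factorial : ℕ) : ℝ) = 1
  have hcongr (x : Fin (m + 1) → ℝ) : x 0 * (nb.factorial : ℝ) *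
      ((nb + (m + 2)).factorial : ℝ) * ∑ b ∈ Finset.Nat.antidiagonalTuple (m + 2) nb,
        ∏ i, extendSimplex (m + 2) x i ^ (2 * b i) /
          (((b i).factorial * (b i + 1).factorial : ℕ) : ℝ) =
      ((nb.factorial : ℝ) * ((nb + (m + 2)).factorial : ℝ)) *
        ∑ b ∈ Finset.Nat.antidiagonalTuple (m + 2) nb,
          x 0 * ∏ i, extendSimplex (m + 2) x i ^ (2 * b i) /
            (((b i).factorial * (b i + 1).factorial : ℕ) : ℝ) := by
    rw [← Finset.mul_sum]
    ring
  simp only [hcongr]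
  rw [integral_const_mul, integral_finsetSum]
  · have hsum : ∑ b ∈ Finset.Nat.antidiagonalTuple (m + 2) nb,
        ∫ x in solidSimplex (m + 1) 1, x 0 * ∏ i, extendSimplex (m + 2) x i ^ (2 * b i) /
          (((b i).factorial * (b i + 1).factorial : ℕ) : ℝ) =
        ((2 * nb + (m + 2)).choose nb : ℝ) / (2 * nb + (m + 2)).factorial := by
      rw [← sum_antidiagonalTuple_catalan (m + 1) nb]
      rw [Nat.cast_sum, Finset.sum_div]
      refine Finset.sum_congr rfl fun b hb => ?_
      rw [setIntegral_mul_prod_extendSimplex, Finset.Nat.mem_antidiagonalTuple.1 hb]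
      push_cast
      rfl
    have hfact := Nat.choose_mul_factorial_mul_factorial (show nb ≤ 2 * nb + (m + 2) by omega)
    rw [show 2 * nb + (m + 2) - nb = nb + (m + 2) by omega] at hfact
    rw [hsum, ← mul_div_assoc, div_eq_one_iff_eq (by positivity), ← hfact]
    push_cast
    ring
  · intro b _
    refine ContinuousOn.integrableOn_compact (isCompact_solidSimplex _ _)
      (Continuous.continuousOn ?_)
    refine (continuous_apply _).mul (continuous_finsetProd _ fun i _ => ?_)
    exact ((continuous_extendSimplex m i).pow _).div_const _
end

section
/- For all integers k ≥ 1 and m ≥ 0: Σ_{(b_0,…,b_{k−1})∈ℕ^k, b_0+⋯+b_{k−1}=m} (2b_0 + 1) · Π_{i=0}^{k−1} C_{b_i} = binom(2m + k, m). -/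
open Finset PowerSeries in
/-- The coefficient of `X ^ n` in a product of power series indexed by `Fin k`, as a sum over
`k`-tuples with sum `n`. -/
theorem PowerSeries.coeff_prod_fin {R : Type*} [CommSemiring R] (k n : ℕ) (f : Fin k → R⟦X⟧) :
    coeff n (∏ i, f i) = ∑ b ∈ Nat.antidiagonalTuple k n, ∏ i, coeff (b i) (f i) := by
  rw [coeff_prod]
  refine sum_bij' (fun l _ => ⇑l) (fun b _ => Finsupp.equivFunOnFinite.symm b) ?_ ?_ ?_ ?_ ?_ <;>
    simp [Nat.mem_antidiagonalTuple]

theorem two_mul_add_one_mul_catalan (n : ℕ) :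
    (2 * n + 1) * catalan n = (2 * n + 1).choose n := by
  have hchoose := Nat.choose_mul_succ_eq (2 * n) n
  rw [← Nat.centralBinom_eq_two_mul_choose, ← succ_mul_catalan_eq_centralBinom,
    show 2 * n + 1 - n = n + 1 by omega] at hchoose
  refine Nat.eq_of_mul_eq_mul_right (Nat.add_one_pos n) ?_
  rw [← hchoose]
  ring

namespace PowerSeries

/-- The generating function of complete binary plane trees marked at a node. -/
def markedCatalanSeries : PowerSeries ℕ := mk fun n => (2 * n + 1) * catalan n

theorem coeff_markedCatalanSeries (n : ℕ) :
    coeff n markedCatalanSeries = (2 * n + 1) * catalan n :=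
  coeff_mk _ _

theorem coeff_markedCatalanSeries_mul_catalanSeries_pow (k m : ℕ) :
    coeff m (markedCatalanSeries * catalanSeries ^ k) = (2 * m + k + 1).choose m := by
  induction m generalizing k with
  | zero => simp [markedCatalanSeries]
  | succ m ihm =>
    induction k with
    | zero => rw [pow_zero, mul_one, coeff_markedCatalanSeries, two_mul_add_one_mul_catalan]
    | succ k ihk =>
      have hrec : markedCatalanSeries * catalanSeries ^ (k + 1) =
          markedCatalanSeries * catalanSeries ^ (k + 2) * X +
            markedCatalanSeries * catalanSeries ^ k := by
        calc _ = markedCatalanSeries * catalanSeries ^ k * catalanSeries := by ring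
          _ = markedCatalanSeries * catalanSeries ^ k * (catalanSeries ^ 2 * X + 1) := by
            rw [catalanSeries_sq_mul_X_add_one]
          _ = _ := by ring
      rw [hrec, map_add, coeff_succ_mul_X, ihm, ihk, Nat.choose_succ_succ]
      congr 2
      ring

end PowerSeries

/-- **Counting marked forests of complete binary trees** (Equation (18) of the paper):
for `k ≥ 1` and `m ≥ 0`,
`Σ_{(b_0,…,b_{k-1}) : Σ b_i = m} (2 b_0 + 1) · Π_i C_{b_i} = binom(2m + k, m)`,
where `C_j` is the `j`-th Catalan number. -/
theorem sum_marked_catalan_tuples (k m : ℕ) (hk : 1 ≤ k) :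
    ∑ b ∈ Finset.Nat.antidiagonalTuple k m,
      (2 * b ⟨0, hk⟩ + 1) * ∏ i : Fin k, catalan (b i) = (2 * m + k).choose m := by
  obtain ⟨k, rfl⟩ := Nat.exists_eq_add_of_le' hk
  have hcoeff := PowerSeries.coeff_prod_fin (k + 1) m
    (Fin.cons PowerSeries.markedCatalanSeries fun _ => PowerSeries.catalanSeries)
  simp only [Fin.prod_univ_succ, Fin.cons_zero, Fin.cons_succ, Finset.prod_const,
    Finset.card_univ, Fintype.card_fin, PowerSeries.coeff_markedCatalanSeries_mul_catalanSeries_pow,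
    PowerSeries.coeff_markedCatalanSeries, PowerSeries.catalanSeries_coeff] at hcoeff
  rw [← add_assoc, hcoeff]
  refine Finset.sum_congr rfl fun b _ => ?_
  rw [Fin.prod_univ_succ, mul_assoc]
  rfl
end

section
/- Let p, q be real numbers with 0 < p < q and p + q ≤ 1, and for every integer ℓ ≥ 0 define f(ℓ) = (q − p) · Σ_{b=0}^{⌊ℓ/2⌋} ((ℓ+1)/(b+1)) · (ℓ! / (b!·b!·(ℓ−2b)!)) · p^b · q^{b+1} · (1−p−q)^{ℓ−2b} (with the convention (1−p−q)^0 = 1). Then Σ_{ℓ=0}^{∞} f(ℓ) = 1. -/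
open Golf

/-- Iterated summation of a nonnegative family over `ℕ × ℕ`. -/
theorem hasSum_prod_of_nonneg {f : ℕ × ℕ → ℝ} {g : ℕ → ℝ} {a : ℝ} (hf : 0 ≤ f)
    (hg : ∀ b, HasSum (fun c => f (b, c)) (g b)) (ha : HasSum g a) : HasSum f a := by
  have hs : Summable f := (summable_prod_of_nonneg hf).mpr
    ⟨fun b => (hg b).summable, by simpa only [(hg _).tsum_eq] using ha.summable⟩
  have h := hs.hasSum.prod_fiberwise hg
  rw [ha.unique h]
  exact hs.hasSum

theorem multinom3_cast (a b c : ℕ) :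
    (multinom3 a b c : ℝ) =
      ((a + b + c).factorial : ℝ) / (a.factorial * b.factorial * c.factorial) := by
  unfold multinom3
  rw [Nat.cast_div]
  · push_cast; rfl
  · exact (Nat.mul_dvd_mul_right (Nat.factorial_mul_factorial_dvd_factorial_add a b) _).trans
      (Nat.factorial_mul_factorial_dvd_factorial_add (a + b) c)
  · positivity

theorem multichoose_half (n : ℕ) :
    Ring.multichoose (1 / 2 : ℝ) n = (n.centralBinom : ℝ) / 4 ^ n := by
  have h (n : ℕ) : (n.factorial : ℝ) * Ring.multichoose (1 / 2 : ℝ) n =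
      (ascPochhammer ℝ n).eval (1 / 2) := by
    rw [← nsmul_eq_mul, Ring.factorial_nsmul_multichoose_eq_ascPochhammer,
      Polynomial.ascPochhammer_smeval_eq_eval]
  induction n with
  | zero => simp
  | succ n ih =>
    have h1 := h (n + 1)
    rw [ascPochhammer_succ_eval, ← h n, ih, Nat.factorial_succ] at h1
    have h2 : ((n : ℝ) + 1) * (n + 1).centralBinom = 2 * (2 * n + 1) * n.centralBinom :=
      mod_cast Nat.succ_mul_centralBinom_succ n
    have h3 : (n.factorial : ℝ) ≠ 0 := by positivity
    have h4 : (n : ℝ) + 1 ≠ 0 := by positivity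
    push_cast at h1
    apply mul_left_cancel₀ (mul_ne_zero h4 h3)
    rw [h1]
    field_simp
    rw [pow_succ]
    linear_combination (-2 * (4 : ℝ) ^ n) * h2

/-- The generating function of the central binomial coefficients. -/
theorem hasSum_centralBinom_mul_pow {x : ℝ} (hx0 : 0 ≤ x) (hx : 4 * x < 1) :
    HasSum (fun n : ℕ => (n.centralBinom : ℝ) * x ^ n) (1 / √(1 - 4 * x)) := by
  have h := (Real.one_div_one_sub_rpow_hasFPowerSeriesOnBall_zero (1 / 2)).hasSum
    (y := 4 * x) (by
      rw [Metric.mem_eball, edist_zero_right, enorm_eq_nnnorm]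
      rw [← ENNReal.coe_one, ENNReal.coe_lt_coe, ← NNReal.coe_lt_coe]
      simpa [abs_of_nonneg hx0] using hx)
  rw [zero_add, ← Real.sqrt_eq_rpow] at h
  convert! h using 2 with n
  rw [FormalMultilinearSeries.ofScalars_apply_eq, ← Ring.multichoose_eq, multichoose_half,
    smul_eq_mul, mul_pow]
  field_simp

theorem hasSum_choose_mul_pow {x s : ℝ} (hx0 : 0 < x) (hs : 0 < s) (h : 1 - 4 * x = s ^ 2) :
    HasSum (fun b : ℕ => ((2 * b + 1).choose b : ℝ) * x ^ b) ((1 / s - 1) / (2 * x)) := by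
  have h1 := hasSum_centralBinom_mul_pow hx0.le (by nlinarith [sq_pos_of_pos hs])
  rw [h, Real.sqrt_sq hs.le, ← hasSum_nat_add_iff' 1] at h1
  convert! h1.div_const (2 * x) using 2 with b
  · have h2 : (b + 1).centralBinom = 2 * (2 * b + 1).choose b := by
      rw [Nat.centralBinom_eq_two_mul_choose, show 2 * (b + 1) = (2 * b + 1) + 1 by ring,
        Nat.choose_succ_succ, Nat.choose_symm_half]
      ring
    rw [h2, pow_succ]
    push_cast
    field_simp
  · simp

theorem multinom3_eq_choose (b c : ℕ) :
    (((2 * b + c : ℕ) : ℝ) + 1) / ((b : ℝ) + 1) * (multinom3 b b c : ℝ) =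
      ((c + (2 * b + 1)).choose (2 * b + 1) : ℝ) * ((2 * b + 1).choose b : ℝ) := by
  rw [multinom3_cast, add_comm c, Nat.cast_add_choose,
    show 2 * b + 1 = b + (b + 1) by ring, Nat.cast_add_choose,
    show b + (b + 1) + c = b + b + c + 1 by ring, Nat.factorial_succ (b + b + c),
    Nat.factorial_succ b, ← two_mul]
  push_cast
  field_simp

/-- **The limit law of the block containing `0` on `ℤ` is a probability law**
(Claim 3.7 of the paper): for `0 < p < q` with `p + q ≤ 1`, setting
`f(ℓ) = (q-p) Σ_{b ≤ ⌊ℓ/2⌋} ((ℓ+1)/(b+1)) (ℓ!/(b! b! (ℓ-2b)!)) p^b q^{b+1} (1-p-q)^{ℓ-2b}`,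
one has `Σ_ℓ f(ℓ) = 1`. -/
theorem block_law_sums_to_one (p q : ℝ) (hp : 0 < p) (hpq : p < q) (hq : p + q ≤ 1) :
    HasSum
      (fun ℓ : ℕ => (q - p) *
        ∑ b ∈ Finset.range (ℓ / 2 + 1),
          ((ℓ : ℝ) + 1) / ((b : ℝ) + 1) * (multinom3 b b (ℓ - 2 * b) : ℝ) *
            p ^ b * q ^ (b + 1) * (1 - p - q) ^ (ℓ - 2 * b))
      1 := by
  set r := 1 - p - q with hr
  have hr0 : 0 ≤ r := by linarith
  have hr1 : ‖r‖ < 1 := by rw [Real.norm_of_nonneg hr0]; linarith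
  have hpq0 : 0 < p + q := by linarith
  have hd : 0 < q - p := sub_pos.mpr hpq
  let t (b c : ℕ) : ℝ := (((2 * b + c : ℕ) : ℝ) + 1) / ((b : ℝ) + 1) *
    (multinom3 b b c : ℝ) * p ^ b * q ^ (b + 1) * r ^ c
  let F : ℕ × ℕ → ℝ := fun z => if 2 * z.1 ≤ z.2 then t z.1 (z.2 - 2 * z.1) else 0
  have ht (b c : ℕ) : 0 ≤ t b c := by
    have := hp.trans hpq
    positivity
  have hF : 0 ≤ F := fun z => by
    simp only [F, Pi.zero_apply]
    split_ifs
    exacts [ht _ _, le_rfl]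
  have hcol (b : ℕ) : HasSum (fun l => F (b, l))
      (q / (p + q) ^ 2 * (((2 * b + 1).choose b : ℝ) * (p * q / (p + q) ^ 2) ^ b)) := by
    rw [← (add_left_injective (2 * b)).hasSum_iff]
    · have h := (hasSum_choose_mul_geometric_of_norm_lt_one (2 * b + 1) hr1).mul_left
        (((2 * b + 1).choose b : ℝ) * p ^ b * q ^ (b + 1))
      convert! h using 1
      · ext c
        simp only [F, t, Function.comp_apply, Nat.add_sub_cancel, Nat.le_add_left, if_true]
        rw [multinom3_eq_choose]
        ring
      · rw [show 1 - r = p + q by rw [hr]; ring, div_pow, mul_pow, ← pow_mul]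
        field_simp
        ring
    · intro l hl
      have : ¬ 2 * b ≤ l := fun h => hl ⟨l - 2 * b, Nat.sub_add_cancel h⟩
      simp [F, this]
  have htot : HasSum F (1 / (q - p)) := by
    refine hasSum_prod_of_nonneg hF hcol ?_
    have hq0 := hp.trans hpq
    convert! (hasSum_choose_mul_pow (x := p * q / (p + q) ^ 2) (s := (q - p) / (p + q))
      (by positivity) (by positivity) (by field_simp; ring)).mul_left (q / (p + q) ^ 2) using 1
    field_simp
    ring
  have hrow := ((Equiv.prodComm ℕ ℕ).hasSum_iff.mpr htot).prod_fiberwise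
    (g := fun l => ∑ b ∈ Finset.range (l / 2 + 1), F (b, l)) (fun l => by
      apply hasSum_sum_of_ne_finset_zero
      intro b hb
      have : ¬ 2 * b ≤ l := by
        rw [Finset.mem_range] at hb
        omega
      simp [F, this])
  convert! hrow.mul_left (q - p) using 1
  · ext l
    congr 1
    refine Finset.sum_congr rfl fun b hb => ?_
    have hb : 2 * b ≤ l := by
      rw [Finset.mem_range] at hb
      omega
    simp only [F, t, hb, if_true, Nat.add_sub_cancel' hb]
  · field_simp
end
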